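/- Let (f_u)_{u≥0} be a normalized Loewner chain on 𝔹ₙ such that {e^{−u} f_u : u ≥ 0} is a normal family, with evolution family φ_{s,t} = f_t⁻¹ ∘ f_s, and for fixed 0 ≤ s ≤ t set h = e^{t−s}·φ_{s,t} ∈ S⁰(𝔹ₙ). Then h is not a support point of S⁰(𝔹ₙ). -/

import Mathlib

open Metric Filter Set MeasureTheory

noncomputable section

/-- ℂⁿ with the Euclidean (Hermitian) norm. -/
abbrev En (n : ℕ) : Type := EuclideanSpace ℂ (Fin n)

/-- The open Euclidean unit ball 𝔹ₙ ⊂ ℂⁿ. -/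
def Ball (n : ℕ) : Set (En n) := Metric.ball 0 1

/-- A map is univalent on 𝔹ₙ if it is holomorphic and injective there. -/
def UnivalentOn (n : ℕ) (f : En n → En n) : Prop :=
  DifferentiableOn ℂ f (Ball n) ∧ Set.InjOn f (Ball n)

/-- The class S(𝔹ₙ): univalent maps with f(0) = 0 and Df(0) = I. -/
def ClassS (n : ℕ) (f : En n → En n) : Prop :=
  UnivalentOn n f ∧ f 0 = 0 ∧ fderiv ℂ f 0 = ContinuousLinearMap.id ℂ (En n)

/-- A Loewner chain on 𝔹ₙ: a family (f_t)_{t ≥ 0} of univalent maps with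
increasing images, locally absolutely continuous in t, uniformly on compacta. -/
def IsLoewnerChain (n : ℕ) (f : ℝ → En n → En n) : Prop :=
  (∀ t, 0 ≤ t → UnivalentOn n (f t)) ∧
  (∀ s t, 0 ≤ s → s ≤ t → f s '' Ball n ⊆ f t '' Ball n) ∧
  (∀ K : Set (En n), K ⊆ Ball n → IsCompact K → ∀ T : ℝ, 0 < T →
    ∃ c : ℝ → ℝ, (∀ τ, 0 ≤ c τ) ∧ IntegrableOn c (Set.Icc 0 T) ∧
      ∀ z ∈ K, ∀ s t : ℝ, 0 ≤ s → s ≤ t → t ≤ T →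
        ‖f s z - f t z‖ ≤ ∫ τ in Set.Icc s t, c τ)

/-- A normalized Loewner chain: f_t(0) = 0 and Df_t(0) = eᵗ·I for all t ≥ 0. -/
def IsNormalizedLoewnerChain (n : ℕ) (f : ℝ → En n → En n) : Prop :=
  IsLoewnerChain n f ∧ ∀ t, 0 ≤ t → f t 0 = 0 ∧
    fderiv ℂ (f t) 0 = (Real.exp t : ℂ) • ContinuousLinearMap.id ℂ (En n)

/-- The family {e^{−t} f_t : t ≥ 0} is a normal family, i.e. locally uniformly
bounded on 𝔹ₙ. -/
def IsNormalFamilyChain (n : ℕ) (f : ℝ → En n → En n) : Prop :=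
  ∀ K : Set (En n), K ⊆ Ball n → IsCompact K →
    ∃ M : ℝ, ∀ t, 0 ≤ t → ∀ z ∈ K, Real.exp (-t) * ‖f t z‖ ≤ M

/-- S⁰(𝔹ₙ): maps of S(𝔹ₙ) with parametric representation, i.e. the initial
element of a normalized Loewner chain (f_t) such that {e^{−t} f_t} is a normal
family. -/
def MemS0 (n : ℕ) (f : En n → En n) : Prop :=
  ClassS n f ∧ ∃ F : ℝ → En n → En n,
    IsNormalizedLoewnerChain n F ∧ IsNormalFamilyChain n F ∧ F 0 = f

/-- The evolution family φ_{s,t} = f_t⁻¹ ∘ f_s of a Loewner chain. -/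
def evolution (n : ℕ) (F : ℝ → En n → En n) (s t : ℝ) : En n → En n :=
  fun z => Function.invFunOn (F t) (Ball n) (F s z)

/-- A ℂ-linear functional on maps 𝔹ₙ → ℂⁿ, continuous with respect to locally
uniform convergence on 𝔹ₙ of holomorphic maps. -/
def IsContinuousLinearFunctional (n : ℕ) (L : (En n → En n) → ℂ) : Prop :=
  (∀ f g : En n → En n, L (f + g) = L f + L g) ∧
  (∀ (c : ℂ) (f : En n → En n), L (c • f) = c * L f) ∧
  (∀ (f : ℕ → En n → En n) (g : En n → En n),
    (∀ k, DifferentiableOn ℂ (f k) (Ball n)) → DifferentiableOn ℂ g (Ball n) →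
    TendstoLocallyUniformlyOn f g atTop (Ball n) →
    Tendsto (fun k => L (f k)) atTop (nhds (L g)))

/-- f is a support point of A ⊆ Hol(𝔹ₙ,ℂⁿ): f ∈ A and there is a continuous
ℂ-linear functional L whose real part is nonconstant on A and is maximized
over A at f. -/
def IsSupportPoint (n : ℕ) (A : Set (En n → En n)) (f : En n → En n) : Prop :=
  f ∈ A ∧ ∃ L : (En n → En n) → ℂ, IsContinuousLinearFunctional n L ∧
    (∃ g₁ ∈ A, ∃ g₂ ∈ A, (L g₁).re ≠ (L g₂).re) ∧
    (∀ g ∈ A, (L g).re ≤ (L f).re)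

section
open scoped Topology

section PartA

section HoloBasics
variable {E F : Type} [NormedAddCommGroup E] [NormedSpace ℂ E]
  [NormedAddCommGroup F] [NormedSpace ℂ F]

lemma hb_fderiv_bound {f : E → F} {x₀ : E} {R M : ℝ} (hR : 0 < R)
    (hf : DifferentiableOn ℂ f (ball x₀ (4 * R))) (hM : ∀ z ∈ ball x₀ (4 * R), ‖f z‖ ≤ M)
    {y : E} (hy : y ∈ ball x₀ (3 * R)) : ‖fderiv ℂ f y‖ ≤ 2 * M / R := by
  have hsub : ball y R ⊆ ball x₀ (4 * R) := by
    apply ball_subset_ball'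
    have := mem_ball.1 hy
    linarith
  apply Complex.norm_fderiv_le_div_of_mapsTo_ball (hf.mono hsub) _ hR
  intro z hz
  rw [mem_closedBall, dist_eq_norm]
  have h1 := hM z (hsub hz)
  have h2 := hM y (hsub (mem_ball_self hR))
  calc ‖f z - f y‖ ≤ ‖f z‖ + ‖f y‖ := norm_sub_le _ _
    _ ≤ 2 * M := by linarith

lemma hb_exists_ball {f : E → F} {U : Set E} (hU : IsOpen U) (hf : DifferentiableOn ℂ f U)
    {x₀ : E} (hx : x₀ ∈ U) : ∃ R > 0, ∃ M : ℝ, 0 ≤ M ∧ ball x₀ (4 * R) ⊆ U ∧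
      ∀ z ∈ ball x₀ (4 * R), ‖f z‖ ≤ M := by
  have hc : ContinuousAt f x₀ := (hf.differentiableAt (hU.mem_nhds hx)).continuousAt
  have h1 : ∀ᶠ z in 𝓝 x₀, ‖f z‖ < ‖f x₀‖ + 1 :=
    hc.norm.eventually (Iio_mem_nhds (by linarith))
  obtain ⟨r, hr, hr'⟩ := Metric.eventually_nhds_iff_ball.1 (h1.and (hU.mem_nhds hx))
  refine ⟨r / 4, by positivity, ‖f x₀‖ + 1, by positivity, ?_, ?_⟩
  · intro z hz
    exact (hr' z (by convert hz using 2; ring)).2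
  · intro z hz
    exact (hr' z (by convert hz using 2; ring)).1.le

lemma hb_continuousOn_fderiv {f : E → F} {U : Set E} (hU : IsOpen U)
    (hf : DifferentiableOn ℂ f U) : ContinuousOn (fderiv ℂ f) U := by
  intro x₀ hx
  apply ContinuousAt.continuousWithinAt
  obtain ⟨R, hR, M, hM0, hsub, hM⟩ := hb_exists_ball hU hf hx
  have hf' := hf.mono hsub
  set C := 2 * M / R with hC
  have hC0 : 0 ≤ C := by positivity
  have hlip : ∀ z ∈ ball x₀ (3 * R), ∀ w ∈ ball x₀ (3 * R), ‖f w - f z‖ ≤ C * ‖w - z‖ := by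
    intro z hz w hw
    apply (convex_ball x₀ (3 * R)).norm_image_sub_le_of_norm_fderiv_le (𝕜 := ℂ) _ _ hz hw
    · intro y hy
      apply hf'.differentiableAt (isOpen_ball.mem_nhds (ball_subset_ball (by linarith) hy))
    · intro y hy
      exact hb_fderiv_bound hR hf' hM hy
  have key : ∀ y ∈ ball x₀ R, ‖fderiv ℂ f y - fderiv ℂ f x₀‖ ≤ (2 * C * ‖y - x₀‖) / R := by
    intro y hy
    have hy' : ‖y - x₀‖ < R := by rwa [mem_ball, dist_eq_norm] at hy
    have hd1 : ∀ z ∈ ball x₀ R, DifferentiableAt ℂ (fun z => f (z + (y - x₀))) z := by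
      intro z hz
      have : DifferentiableAt ℂ f (z + (y - x₀)) := by
        apply hf'.differentiableAt (isOpen_ball.mem_nhds _)
        rw [mem_ball, dist_eq_norm] at hz ⊢
        calc ‖z + (y - x₀) - x₀‖ = ‖(z - x₀) + (y - x₀)‖ := by congr 1; abel
          _ ≤ ‖z - x₀‖ + ‖y - x₀‖ := norm_add_le _ _
          _ < 4 * R := by linarith
      exact this.comp z (by fun_prop)
    have hd2 : ∀ z ∈ ball x₀ R, DifferentiableAt ℂ f z := fun z hz =>
      hf'.differentiableAt (isOpen_ball.mem_nhds (ball_subset_ball (by linarith) hz))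
    have hx0 : x₀ ∈ ball x₀ R := mem_ball_self hR
    have e : fderiv ℂ (fun z => f (z + (y - x₀)) - f z) x₀ = fderiv ℂ f y - fderiv ℂ f x₀ := by
      rw [fderiv_fun_sub (hd1 _ hx0) (hd2 _ hx0), fderiv_comp_add_right]
      simp
    rw [← e]
    apply Complex.norm_fderiv_le_div_of_mapsTo_ball (R₁ := R) _ _ hR
    · intro z hz
      exact ((hd1 z hz).sub (hd2 z hz)).differentiableWithinAt
    · intro z hz
      rw [mem_closedBall, dist_eq_norm]
      have hzR : ‖z - x₀‖ < R := by rwa [mem_ball, dist_eq_norm] at hz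
      have a1 : ‖f (z + (y - x₀)) - f z‖ ≤ C * ‖y - x₀‖ := by
        have := hlip z (ball_subset_ball (by linarith) hz) (z + (y - x₀)) (by
          rw [mem_ball, dist_eq_norm]
          calc ‖z + (y - x₀) - x₀‖ = ‖(z - x₀) + (y - x₀)‖ := by congr 1; abel
            _ ≤ ‖z - x₀‖ + ‖y - x₀‖ := norm_add_le _ _
            _ < 3 * R := by linarith)
        simpa using this
      have a2 : ‖f (x₀ + (y - x₀)) - f x₀‖ ≤ C * ‖y - x₀‖ := by
        have := hlip x₀ (mem_ball_self (by linarith)) (x₀ + (y - x₀)) (by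
          rw [mem_ball, dist_eq_norm]
          simp only [add_sub_cancel]; linarith)
        simpa using this
      calc _ ≤ ‖f (z + (y - x₀)) - f z‖ + ‖f (x₀ + (y - x₀)) - f x₀‖ := norm_sub_le _ _
        _ ≤ 2 * C * ‖y - x₀‖ := by linarith
  rw [ContinuousAt, tendsto_iff_norm_sub_tendsto_zero]
  have ht : Tendsto (fun y => (2 * C * ‖y - x₀‖) / R) (𝓝 x₀) (𝓝 0) := by
    have : ContinuousAt (fun y => (2 * C * ‖y - x₀‖) / R) x₀ := by fun_prop
    simpa [ContinuousAt] using this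
  refine squeeze_zero' (Eventually.of_forall fun _ => norm_nonneg _) ?_ ht
  filter_upwards [ball_mem_nhds x₀ hR] with y hy using key y hy

lemma hb_fderiv_apply [CompleteSpace F] {f : E → F} {U : Set E} (hU : IsOpen U)
    (hf : DifferentiableOn ℂ f U) (v : E) : DifferentiableOn ℂ (fun z => fderiv ℂ f z v) U := by
  intro x₀ hx
  apply DifferentiableAt.differentiableWithinAt
  obtain ⟨R, hR, M, hM0, hsub, hM⟩ := hb_exists_ball hU hf hx
  have hf' := hf.mono hsub
  set ρ := R / (‖v‖ + 1) with hρ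
  have hρ0 : 0 < ρ := by positivity
  have hρv : ρ * ‖v‖ ≤ R := by
    rw [hρ, div_mul_eq_mul_div, div_le_iff₀ (by positivity)]
    nlinarith [norm_nonneg v]
  have hmem : ∀ x ∈ ball x₀ R, ∀ ζ : ℂ, ‖ζ‖ ≤ ρ → x + ζ • v ∈ ball x₀ (3 * R) := by
    intro x hx ζ hζ
    rw [mem_ball, dist_eq_norm] at hx ⊢
    have : ‖ζ • v‖ ≤ R := by
      rw [norm_smul]
      exact (mul_le_mul_of_nonneg_right hζ (norm_nonneg _)).trans hρv
    calc ‖x + ζ • v - x₀‖ = ‖(x - x₀) + ζ • v‖ := by congr 1; abel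
      _ ≤ ‖x - x₀‖ + ‖ζ • v‖ := norm_add_le _ _
      _ < 3 * R := by linarith
  have hdiff : ∀ y ∈ ball x₀ (3 * R), DifferentiableAt ℂ f y := fun y hy =>
    hf'.differentiableAt (isOpen_ball.mem_nhds (ball_subset_ball (by linarith) hy))
  have hform : ∀ x ∈ ball x₀ R, fderiv ℂ f x v = (2 * (Real.pi : ℂ) * Complex.I)⁻¹ •
      ∮ z in C(0, ρ), (1 / (z - 0) ^ 2) • f (x + z • v) := by
    intro x hx
    have hd : ∀ ζ : ℂ, ‖ζ‖ ≤ ρ → DifferentiableAt ℂ (fun ζ : ℂ => f (x + ζ • v)) ζ := by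
      intro ζ hζ
      exact (hdiff _ (hmem x hx ζ hζ)).comp ζ (by fun_prop)
    have hdc : DiffContOnCl ℂ (fun ζ : ℂ => f (x + ζ • v)) (ball 0 ρ) := by
      constructor
      · intro ζ hζ
        exact (hd ζ (by simpa using (mem_ball_zero_iff.1 hζ).le)).differentiableWithinAt
      · rw [closure_ball _ hρ0.ne']
        intro ζ hζ
        exact (hd ζ (by simpa using hζ)).continuousAt.continuousWithinAt
    rw [hdc.deriv_eq_smul_circleIntegral hρ0, smul_smul, inv_mul_cancel₀, one_smul]
    · have h1 : HasFDerivAt f (fderiv ℂ f x) (x + (0 : ℂ) • v) := by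
        simpa using (hdiff x (by simpa using hmem x hx 0 (by simpa using hρ0.le))).hasFDerivAt
      have h2 : HasDerivAt (fun ζ : ℂ => x + ζ • v) v 0 := by
        simpa using ((hasDerivAt_id (0 : ℂ)).smul_const v).const_add x
      exact ((h1.comp_hasDerivAt (0 : ℂ) h2).deriv).symm
    · simp [Real.pi_ne_zero]
  have hev : (fun x => (2 * (Real.pi : ℂ) * Complex.I)⁻¹ •
      ∮ z in C(0, ρ), (1 / (z - 0) ^ 2) • f (x + z • v)) =ᶠ[𝓝 x₀] fun x => fderiv ℂ f x v := by
    filter_upwards [ball_mem_nhds x₀ hR] with x hx using (hform x hx).symm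
  refine DifferentiableAt.congr_of_eventuallyEq ?_ hev.symm
  apply DifferentiableAt.const_smul
  simp only [circleIntegral]
  set κ : ℝ → ℂ := fun θ => deriv (circleMap 0 ρ) θ * (1 / (circleMap 0 ρ θ - 0) ^ 2) with hκ
  have hcκ : Continuous κ := by
    have h0 : ∀ θ, circleMap 0 ρ θ - 0 ≠ 0 := fun θ => by
      simpa using (circleMap_ne_center hρ0.ne' : circleMap 0 ρ θ ≠ 0)
    simp only [hκ, deriv_circleMap]
    refine Continuous.mul (by fun_prop) (Continuous.div (by fun_prop) (by fun_prop) ?_)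
    intro θ
    exact pow_ne_zero 2 (h0 θ)
  have hnorm : ∀ θ, ‖circleMap 0 ρ θ‖ ≤ ρ := by
    intro θ; simp [abs_of_pos hρ0]
  have hcont : ∀ x ∈ ball x₀ R, Continuous fun θ => f (x + circleMap 0 ρ θ • v) := by
    intro x hx
    rw [continuous_iff_continuousAt]
    intro θ
    have := (hdiff _ (hmem x hx _ (hnorm θ))).continuousAt
    exact ContinuousAt.comp (f := fun θ => x + circleMap 0 ρ θ • v) this (by fun_prop)
  have hcont' : Continuous fun θ => fderiv ℂ f (x₀ + circleMap 0 ρ θ • v) := by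
    rw [continuous_iff_continuousAt]
    intro θ
    have h3 := hmem x₀ (mem_ball_self hR) _ (hnorm θ)
    have := (hb_continuousOn_fderiv isOpen_ball hf').continuousAt
      (isOpen_ball.mem_nhds (ball_subset_ball (by linarith) h3))
    exact ContinuousAt.comp (f := fun θ => x₀ + circleMap 0 ρ θ • v) this (by fun_prop)
  have := intervalIntegral.hasFDerivAt_integral_of_dominated_of_fderiv_le (𝕜 := ℂ) (μ := volume)
    (a := 0) (b := 2 * Real.pi) (x₀ := x₀) (s := ball x₀ R)
    (F := fun x θ => κ θ • f (x + circleMap 0 ρ θ • v))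
    (F' := fun x θ => κ θ • fderiv ℂ f (x + circleMap 0 ρ θ • v))
    (bound := fun θ => ‖κ θ‖ * (2 * M / R)) (ball_mem_nhds x₀ hR)
    (by
      filter_upwards [ball_mem_nhds x₀ hR] with x hx
      exact (hcκ.smul (hcont x hx)).aestronglyMeasurable)
    ((hcκ.smul (hcont x₀ (mem_ball_self hR))).intervalIntegrable _ _)
    ((hcκ.smul hcont').aestronglyMeasurable)
    (by
      refine Eventually.of_forall fun θ _ x hx => ?_
      rw [norm_smul]
      exact mul_le_mul_of_nonneg_left (hb_fderiv_bound hR hf' hM (hmem x hx _ (hnorm θ)))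
        (norm_nonneg _))
    (by
      apply Continuous.intervalIntegrable
      fun_prop)
    (by
      refine Eventually.of_forall fun θ _ x hx => ?_
      have h1 := (hdiff _ (hmem x hx _ (hnorm θ))).hasFDerivAt
      have h2 : HasFDerivAt (fun x : E => x + circleMap 0 ρ θ • v)
        (ContinuousLinearMap.id ℂ E) x := (hasFDerivAt_id x).add_const _
      have h3 := (h1.comp x h2).const_smul (κ θ)
      exact h3)
  have h5 := this.differentiableAt
  simpa only [hκ, smul_smul] using h5

lemma hb_fderiv [CompleteSpace F] [FiniteDimensional ℂ E] {f : E → F} {U : Set E} (hU : IsOpen U)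
    (hf : DifferentiableOn ℂ f U) : DifferentiableOn ℂ (fderiv ℂ f) U := by
  have hd : Module.finrank ℂ E = Module.finrank ℂ (Fin (Module.finrank ℂ E) → ℂ) :=
    (Module.finrank_fin_fun ℂ).symm
  let e₁ := ContinuousLinearEquiv.ofFinrankEq hd
  let e₂ := (e₁.arrowCongr (1 : F ≃L[ℂ] F)).trans
    (ContinuousLinearEquiv.piRing (Fin (Module.finrank ℂ E)))
  rw [← Function.id_comp (fderiv ℂ f), ← e₂.symm_comp_self]
  exact e₂.symm.differentiable.comp_differentiableOn
    (differentiableOn_pi.mpr fun i => hb_fderiv_apply hU hf _)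

lemma hb_contDiffOn_nat [FiniteDimensional ℂ E] (k : ℕ) : ∀ {F : Type} [NormedAddCommGroup F]
    [NormedSpace ℂ F] [CompleteSpace F] {f : E → F} {U : Set E} (_ : IsOpen U)
    (_ : DifferentiableOn ℂ f U), ContDiffOn ℂ k f U := by
  induction k with
  | zero => 
    intro F _ _ _ f U hU hf
    simpa using hf.continuousOn
  | succ k ih =>
    intro F _ _ _ f U hU hf
    have := (contDiffOn_succ_iff_fderiv_of_isOpen (n := (k : WithTop ℕ∞)) hU).2
      ⟨hf, by simp, ih hU (hb_fderiv hU hf)⟩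
    exact_mod_cast this

lemma hb_contDiffOn [FiniteDimensional ℂ E] [CompleteSpace F] {f : E → F} {U : Set E}
    (hU : IsOpen U) (hf : DifferentiableOn ℂ f U) : ContDiffOn ℂ (⊤ : ℕ∞) f U :=
  contDiffOn_infty.2 fun k => hb_contDiffOn_nat k hU hf

lemma hb_strict [CompleteSpace F] {f : E → F} {U : Set E}
    (hU : IsOpen U) (hf : DifferentiableOn ℂ f U) {x : E} (hx : x ∈ U) :
    HasStrictFDerivAt f (fderiv ℂ f x) x := by
  apply hasStrictFDerivAt_of_hasFDerivAt_of_continuousAt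
  · filter_upwards [hU.mem_nhds hx] with y hy
    exact (hf.differentiableAt (hU.mem_nhds hy)).hasFDerivAt
  · exact (hb_continuousOn_fderiv hU hf).continuousAt (hU.mem_nhds hx)

end HoloBasics

end PartA

section PartB

lemma os_minmod {g : ℂ → ℂ} {z : ℂ} {ρ κ : ℝ} (hρ : 0 < ρ)
    (hg : DifferentiableOn ℂ g (closedBall z ρ))
    (hκ : ∀ ζ ∈ sphere z ρ, κ ≤ ‖g ζ‖) (hz : ‖g z‖ < κ) : ∃ ζ ∈ ball z ρ, g ζ = 0 := by
  by_contra! hcon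
  have hκ0 : 0 < κ := (norm_nonneg _).trans_lt hz
  have hne : ∀ ζ ∈ closure (ball z ρ), g ζ ≠ 0 := by
    intro ζ hζ
    rw [closure_ball _ hρ.ne', ← ball_union_sphere] at hζ
    rcases hζ with h | h
    · exact hcon ζ h
    · intro h0
      have := hκ ζ h
      rw [h0, norm_zero] at this
      linarith
  have hd : DiffContOnCl ℂ g (ball z ρ) := by
    apply DifferentiableOn.diffContOnCl
    rwa [closure_ball _ hρ.ne']
  have h1 := Complex.norm_le_of_forall_mem_frontier_norm_le isBounded_ball (hd.inv hne)
    (C := κ⁻¹) (z := z) (by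
      intro ζ hζ
      rw [frontier_ball _ hρ.ne'] at hζ
      simp only [Pi.inv_apply, norm_inv]
      exact inv_anti₀ hκ0 (hκ ζ hζ)) (subset_closure (mem_ball_self hρ))
  simp only [Pi.inv_apply, norm_inv] at h1
  have hz0 : 0 < ‖g z‖ := norm_pos_iff.2 (hne z (subset_closure (mem_ball_self hρ)))
  have := (inv_le_inv₀ hz0 hκ0).1 h1
  linarith

lemma os_dim_one {f : ℂ → ℂ} {U : Set ℂ} (hU : IsOpen U) (hf : DifferentiableOn ℂ f U)
    (hinj : InjOn f U) {z₀ : ℂ} (hz₀ : z₀ ∈ U) : deriv f z₀ ≠ 0 := by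
  intro hder
  obtain ⟨ρ, hρ, hsub⟩ := Metric.nhds_basis_closedBall.mem_iff.1 (hU.mem_nhds hz₀)
  have hne : (sphere z₀ ρ).Nonempty := NormedSpace.sphere_nonempty.2 hρ.le
  obtain ⟨ζ₁, hζ₁, hmin⟩ := (isCompact_sphere z₀ ρ).exists_isMinOn hne
    (f := fun ζ => ‖f ζ - f z₀‖) (((hf.continuousOn.mono
      (sphere_subset_closedBall.trans hsub)).sub continuousOn_const).norm)
  set μ := ‖f ζ₁ - f z₀‖ / 2 with hμ
  have hμ0 : 0 < μ := by
    have : f ζ₁ - f z₀ ≠ 0 := by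
      rw [sub_ne_zero]
      intro h
      have := hinj (hsub (sphere_subset_closedBall hζ₁)) hz₀ h
      rw [this] at hζ₁
      simp at hζ₁
      linarith
    positivity
  have hda : DifferentiableAt ℂ f z₀ := hf.differentiableAt (hU.mem_nhds hz₀)
  have h1 : ∀ᶠ c in 𝓝[≠] z₀, ‖slope f z₀ c‖ < μ / (2 * ρ) := by
    have := hda.hasDerivAt.tendsto_slope.norm
    rw [hder, norm_zero] at this
    exact this.eventually (Iio_mem_nhds (by positivity))
  have h2 : ∀ᶠ c in 𝓝[≠] z₀, ‖f c - f z₀‖ < μ := by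
    have : ContinuousAt (fun c => ‖f c - f z₀‖) z₀ := (hda.continuousAt.sub continuousAt_const).norm
    have h3 := this.tendsto
    simp only [sub_self, norm_zero] at h3
    exact (h3.eventually (Iio_mem_nhds hμ0)).filter_mono nhdsWithin_le_nhds
  have h3 : ∀ᶠ c in 𝓝[≠] z₀, c ∈ ball z₀ ρ :=
    nhdsWithin_le_nhds (ball_mem_nhds z₀ hρ)
  have h4 : ∀ᶠ c in 𝓝[≠] z₀, deriv f c = 0 := by
    filter_upwards [h1, h2, h3, self_mem_nhdsWithin] with c hc1 hc2 hc3 hc4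
    have hcU : c ∈ U := hsub (ball_subset_closedBall hc3)
    have hdd : DifferentiableOn ℂ (dslope f c) (closedBall z₀ ρ) :=
      ((Complex.differentiableOn_dslope (hU.mem_nhds hcU)).2 hf).mono hsub
    obtain ⟨ζ, hζ, hζ0⟩ := os_minmod (κ := μ / (2 * ρ)) hρ hdd (by
      intro ζ hζ
      have hζc : ζ ≠ c := by
        rintro rfl
        rw [mem_sphere] at hζ
        rw [mem_ball] at hc3
        linarith
      rw [dslope_of_ne _ hζc, slope_def_field, norm_div]
      have ha : 2 * μ ≤ ‖f ζ - f z₀‖ := by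
        have := hmin hζ
        simp only [mem_setOf_eq] at this
        rw [hμ]; linarith
      have hb : μ ≤ ‖f ζ - f c‖ := by
        have := norm_sub_le (f ζ - f c) (f z₀ - f c)
        have h5 : f ζ - f c - (f z₀ - f c) = f ζ - f z₀ := by ring
        rw [h5, norm_sub_rev (f z₀)] at this
        linarith
      have hd : ‖ζ - c‖ ≤ 2 * ρ := by
        rw [← dist_eq_norm]
        have := dist_triangle ζ z₀ c
        rw [mem_sphere] at hζ
        rw [mem_ball, dist_comm] at hc3
        linarith
      have hd0 : 0 < ‖ζ - c‖ := norm_pos_iff.2 (sub_ne_zero.2 hζc)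
      gcongr) (by
      rw [dslope_of_ne _ (Ne.symm hc4), slope_comm]
      exact hc1)
    by_cases hζc : ζ = c
    · rwa [hζc, dslope_same] at hζ0
    · exfalso
      rw [dslope_of_ne _ hζc, slope_def_field, div_eq_zero_iff] at hζ0
      rcases hζ0 with h | h
      · exact hζc (hinj (hsub (ball_subset_closedBall hζ)) hcU (sub_eq_zero.1 h))
      · exact hζc (sub_eq_zero.1 h)
  have h5 : ∀ᶠ c in 𝓝 z₀, deriv f c = 0 := by
    rw [eventually_nhdsWithin_iff] at h4
    filter_upwards [h4] with c hc
    by_cases h : c = z₀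
    · rw [h, hder]
    · exact hc h
  obtain ⟨r, hr, hr'⟩ := Metric.eventually_nhds_iff_ball.1 (h5.and (hU.mem_nhds hz₀))
  have hcst : f (z₀ + (r / 2 : ℝ)) = f z₀ := by
    have hm : z₀ + (r / 2 : ℝ) ∈ ball z₀ r := by
      simp [abs_of_pos hr]; linarith
    have := (convex_ball z₀ r).norm_image_sub_le_of_norm_deriv_le (f := f) (C := 0)
      (fun x hx => hf.differentiableAt (hU.mem_nhds (hr' x hx).2))
      (fun x hx => by rw [(hr' x hx).1, norm_zero]) (mem_ball_self hr) hm
    rw [zero_mul, norm_le_zero_iff, sub_eq_zero] at this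
    exact this
  have hm : z₀ + (r / 2 : ℝ) ∈ ball z₀ r := by
    simp [abs_of_pos hr]; linarith
  have := hinj (hr' _ hm).2 hz₀ hcst
  simp at this
  linarith

section twovar
variable {J : ℂ × ℂ → ℂ} {W : Set (ℂ × ℂ)}

lemma os_slice_diff (hW : IsOpen W) (hJ : DifferentiableOn ℂ J W) {c ζ : ℂ} (h : (c, ζ) ∈ W) :
    HasDerivAt (fun ζ => J (c, ζ)) (fderiv ℂ J (c, ζ) (0, 1)) ζ := by
  have h1 := (hJ.differentiableAt (hW.mem_nhds h)).hasFDerivAt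
  have h2 : HasDerivAt (fun ζ : ℂ => (c, ζ)) ((0 : ℂ), (1 : ℂ)) ζ :=
    (hasDerivAt_const ζ c).prodMk (hasDerivAt_id ζ)
  exact h1.comp_hasDerivAt ζ h2

lemma os_slice_mem (hW : IsOpen W) {c ζ : ℂ} (h : (c, ζ) ∈ W) : ∀ᶠ ζ' in 𝓝 ζ, (c, ζ') ∈ W := by
  have : ContinuousAt (fun ζ' : ℂ => (c, ζ')) ζ := by fun_prop
  exact this (hW.mem_nhds h)

lemma os_slice_analytic (hW : IsOpen W) (hJ : DifferentiableOn ℂ J W) {c ζ : ℂ}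
    (h : (c, ζ) ∈ W) : AnalyticAt ℂ (fun ζ => J (c, ζ)) ζ := by
  rw [Complex.analyticAt_iff_eventually_differentiableAt]
  filter_upwards [os_slice_mem hW h] with ζ' h'
  exact (os_slice_diff hW hJ h').differentiableAt

lemma os_persist (hW : IsOpen W) (hJ : DifferentiableOn ℂ J W) {c₁ ζ₁ : ℂ} (hp : (c₁, ζ₁) ∈ W)
    (h0 : J (c₁, ζ₁) = 0) (hne : ¬ ∀ᶠ ζ in 𝓝 ζ₁, J (c₁, ζ) = 0) {ε : ℝ} (hε : 0 < ε) :
    ∀ᶠ c in 𝓝 c₁, ∃ ζ ∈ ball ζ₁ ε, (c, ζ) ∈ W ∧ J (c, ζ) = 0 := by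
  have h1 : ∀ᶠ ζ in 𝓝[≠] ζ₁, J (c₁, ζ) ≠ 0 :=
    ((os_slice_analytic hW hJ hp).eventually_eq_zero_or_eventually_ne_zero).resolve_left hne
  rw [eventually_nhdsWithin_iff] at h1
  obtain ⟨r₁, hr₁, hr₁'⟩ := Metric.eventually_nhds_iff_ball.1 h1
  obtain ⟨r₂, hr₂, hr₂'⟩ := Metric.isOpen_iff.1 hW _ hp
  set ρ := min ε (min r₁ r₂) / 2 with hρ
  have hm : 0 < min ε (min r₁ r₂) := lt_min hε (lt_min hr₁ hr₂)
  have hρ0 : 0 < ρ := by positivity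
  have hρε : ρ < ε := by have := min_le_left ε (min r₁ r₂); rw [hρ]; linarith
  have hρ1 : ρ < r₁ := by
    have := (min_le_right ε (min r₁ r₂)).trans (min_le_left _ _); rw [hρ]; linarith
  have hρ2 : ρ < r₂ := by
    have := (min_le_right ε (min r₁ r₂)).trans (min_le_right _ _); rw [hρ]; linarith
  have hin : ∀ c ∈ ball c₁ r₂, ∀ ζ ∈ closedBall ζ₁ ρ, (c, ζ) ∈ W := by
    intro c hc ζ hζ
    apply hr₂'
    rw [mem_ball, Prod.dist_eq]
    exact max_lt hc ((mem_closedBall.1 hζ).trans_lt hρ2)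
  have hc1 : c₁ ∈ ball c₁ r₂ := mem_ball_self hr₂
  obtain ⟨ζ₂, hζ₂, hmin⟩ := (isCompact_sphere ζ₁ ρ).exists_isMinOn
    (NormedSpace.sphere_nonempty.2 hρ0.le) (f := fun ζ => ‖J (c₁, ζ)‖) (by
      intro ζ hζ
      exact (os_slice_diff hW hJ (hin _ hc1 ζ
        (sphere_subset_closedBall hζ))).continuousAt.norm.continuousWithinAt)
  set κ := ‖J (c₁, ζ₂)‖ / 2 with hκ
  have hκ0 : 0 < κ := by
    have : J (c₁, ζ₂) ≠ 0 := by
      have h3 : dist ζ₂ ζ₁ = ρ := hζ₂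
      apply hr₁' ζ₂ (by rw [mem_ball]; linarith)
      intro h
      have h4 : ζ₂ = ζ₁ := h
      rw [h4, dist_self] at h3; linarith
    positivity
  have hA : ∀ᶠ c in 𝓝 c₁, ∀ ζ ∈ sphere ζ₁ ρ, κ < ‖J (c, ζ)‖ := by
    apply (isCompact_sphere ζ₁ ρ).eventually_forall_of_forall_eventually
    intro ζ hζ
    have hcont := (hJ.differentiableAt (hW.mem_nhds (hin _ hc1 ζ
        (sphere_subset_closedBall hζ)))).continuousAt.norm
    refine hcont.eventually (Ioi_mem_nhds ?_)
    have := hmin hζ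
    simp only [mem_setOf_eq] at this
    linarith
  have hB : ∀ᶠ c in 𝓝 c₁, ‖J (c, ζ₁)‖ < κ := by
    have hcont : ContinuousAt (fun c => ‖J (c, ζ₁)‖) c₁ :=
      ContinuousAt.norm (ContinuousAt.comp (f := fun c => (c, ζ₁))
        (hJ.differentiableAt (hW.mem_nhds hp)).continuousAt (by fun_prop))
    refine hcont.eventually (Iio_mem_nhds ?_)
    simpa [h0] using hκ0
  filter_upwards [hA, hB, ball_mem_nhds c₁ hr₂] with c h2 h3 h4
  obtain ⟨ζ, hζ, hζ0⟩ := os_minmod (g := fun ζ => J (c, ζ)) hρ0 (fun ζ hζ =>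
    (os_slice_diff hW hJ (hin c h4 ζ hζ)).differentiableAt.differentiableWithinAt)
    (fun ζ hζ => (h2 ζ hζ).le) h3
  exact ⟨ζ, ball_subset_ball hρε.le hζ, hin c h4 ζ (ball_subset_closedBall hζ), hζ0⟩

/-- iterated derivatives in the second variable -/
noncomputable def osD (J : ℂ × ℂ → ℂ) : ℕ → ℂ × ℂ → ℂ
  | 0 => J
  | j + 1 => fun p => fderiv ℂ (osD J j) p (0, 1)

lemma osD_diff (hW : IsOpen W) (hJ : DifferentiableOn ℂ J W) (j : ℕ) :
    DifferentiableOn ℂ (osD J j) W := by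
  induction j with
  | zero => exact hJ
  | succ j ih => exact hb_fderiv_apply hW ih _

lemma osD_iter (hW : IsOpen W) (hJ : DifferentiableOn ℂ J W) (j : ℕ) : ∀ {c ζ : ℂ},
    (c, ζ) ∈ W → iteratedDeriv j (fun ζ => J (c, ζ)) ζ = osD J j (c, ζ) := by
  induction j with
  | zero => intro c ζ _; simp [osD]
  | succ j ih =>
    intro c ζ h
    rw [iteratedDeriv_succ]
    have : iteratedDeriv j (fun ζ => J (c, ζ)) =ᶠ[𝓝 ζ] fun ζ => osD J j (c, ζ) := by
      filter_upwards [os_slice_mem hW h] with ζ' h' using ih h'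
    rw [this.deriv_eq, (os_slice_diff hW (osD_diff hW hJ j) h).deriv]
    rfl

lemma os_zcurve (hW : IsOpen W) (hJ : DifferentiableOn ℂ J W) (h0 : ((0 : ℂ), (0 : ℂ)) ∈ W)
    (hJ0 : J (0, 0) = 0) (hne : ¬ ∀ᶠ ζ in 𝓝 0, J (0, ζ) = 0) :
    ∃ c₁ : ℂ, ∃ γ : ℂ → ℂ, ∃ K, ∃ s ∈ 𝓝 c₁, LipschitzOnWith K γ s ∧
      ∀ c ∈ s, (c, γ c) ∈ W ∧ J (c, γ c) = 0 := by
  classical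
  have hex : ∃ j, ∃ p ∈ W, J p = 0 ∧ osD J j p ≠ 0 := by
    by_contra! hcon
    apply hne
    obtain ⟨r, hr, hr'⟩ := Metric.eventually_nhds_iff_ball.1 (os_slice_mem hW h0)
    filter_upwards [ball_mem_nhds (0 : ℂ) hr] with ζ hζ
    have hd : DifferentiableOn ℂ (fun ζ => J (0, ζ)) (ball 0 r) := fun ζ hζ =>
      (os_slice_diff hW hJ (hr' ζ hζ)).differentiableAt.differentiableWithinAt
    have hs := Complex.hasSum_taylorSeries_on_ball hd hζ
    have hz : ∀ k, iteratedDeriv k (fun ζ => J (0, ζ)) 0 = 0 := fun k => by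
      rw [osD_iter hW hJ k h0]; exact hcon k _ h0 hJ0
    simp only [hz, smul_zero] at hs
    exact hs.unique hasSum_zero
  obtain ⟨p, hpW, hp0, hpm⟩ := Nat.find_spec hex
  have hlt : ∀ j < Nat.find hex, ∀ q ∈ W, J q = 0 → osD J j q = 0 := by
    intro j hj q hq hq0
    by_contra h
    exact Nat.find_min hex hj ⟨q, hq, hq0, h⟩
  generalize Nat.find hex = m at hpm hlt
  obtain _ | m := m
  · exact absurd hp0 hpm
  obtain ⟨c₁, ζ₁⟩ := p
  have hh : ∀ q ∈ W, J q = 0 → osD J m q = 0 := hlt m (Nat.lt_succ_self m)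
  have hstr := hb_strict hW (osD_diff hW hJ m) hpW
  have hinv : (fderiv ℂ (osD J m) (c₁, ζ₁) ∘L .inr ℂ ℂ ℂ).IsInvertible := by
    have hne : fderiv ℂ (osD J m) (c₁, ζ₁) (0, 1) ≠ 0 := hpm
    refine ContinuousLinearMap.IsInvertible.of_inverse
      (g := (fderiv ℂ (osD J m) (c₁, ζ₁) (0, 1))⁻¹ • ContinuousLinearMap.id ℂ ℂ) ?_ ?_
    · ext; simp [hne]
    · ext; simp [hne]
  set γ := hstr.implicitFunctionOfProdDomain hinv with hγ
  have hev := hstr.eventually_apply_eq_iff_implicitFunctionOfProdDomain hinv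
  obtain ⟨K, s, hs, hK⟩ :=
    (hstr.hasStrictFDerivAt_implicitFunctionOfProdDomain hinv).exists_lipschitzOnWith
  obtain ⟨ε, hε, hε'⟩ := Metric.eventually_nhds_iff_ball.1 hev
  have hnz : ¬ ∀ᶠ ζ in 𝓝 ζ₁, J (c₁, ζ) = 0 := by
    intro h
    apply hpm
    rw [← osD_iter hW hJ (m + 1) hpW]
    have h' : (fun ζ => J (c₁, ζ)) =ᶠ[𝓝 ζ₁] fun _ => (0 : ℂ) := h
    rw [h'.iteratedDeriv_eq]
    simp
  have hper := os_persist hW hJ hpW hp0 hnz hε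
  have hfin : ∀ᶠ c in 𝓝 c₁, (c, γ c) ∈ W ∧ J (c, γ c) = 0 := by
    filter_upwards [hper, ball_mem_nhds c₁ hε] with c ⟨ζ, hζ, hcW, hc0⟩ hcb
    have h1 := (hε' (c, ζ) (by
      rw [mem_ball, Prod.dist_eq]
      exact max_lt hcb hζ)).1 (by rw [hh _ hcW hc0, hh _ hpW hp0])
    have h1' : γ c = ζ := h1
    rw [h1']
    exact ⟨hcW, hc0⟩
  refine ⟨c₁, γ, K, s ∩ {c | (c, γ c) ∈ W ∧ J (c, γ c) = 0}, inter_mem hs hfin,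
    hK.mono inter_subset_left, fun c hc => hc.2⟩
end twovar

end PartB

section PartB2

def OsP (d : ℕ) : Prop :=
  ∀ (E F : Type) [NormedAddCommGroup E] [NormedSpace ℂ E] [FiniteDimensional ℂ E]
    [NormedAddCommGroup F] [NormedSpace ℂ F] [FiniteDimensional ℂ F],
    Module.finrank ℂ E = d → Module.finrank ℂ F = d → ∀ (U : Set E) (f : E → F),
    IsOpen U → DifferentiableOn ℂ f U → InjOn f U → ∀ z ∈ U, Function.Injective (fderiv ℂ f z)

lemma os_rank {d : ℕ} (IH : ∀ k < d, OsP k) {E F : Type} [NormedAddCommGroup E] [NormedSpace ℂ E]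
    [FiniteDimensional ℂ E] [NormedAddCommGroup F] [NormedSpace ℂ F] [FiniteDimensional ℂ F]
    (hE : Module.finrank ℂ E = d) (hF : Module.finrank ℂ F = d) {U : Set E} {f : E → F}
    (hU : IsOpen U) (hf : DifferentiableOn ℂ f U) (hinj : InjOn f U) {z₀ : E} (hz₀ : z₀ ∈ U)
    (hni : ¬ Function.Injective (fderiv ℂ f z₀)) : fderiv ℂ f z₀ = 0 := by
  have : CompleteSpace E := FiniteDimensional.complete ℂ E
  have : CompleteSpace F := FiniteDimensional.complete ℂ F
  by_contra hne
  set A : E →ₗ[ℂ] F := (fderiv ℂ f z₀ : E →ₗ[ℂ] F) with hA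
  set K := LinearMap.ker A with hK
  set R := LinearMap.range A with hR
  have hKne : K ≠ ⊥ := fun h => hni (LinearMap.ker_eq_bot.1 h)
  have hsum : Module.finrank ℂ R + Module.finrank ℂ K = d := by
    rw [← hE]; exact LinearMap.finrank_range_add_finrank_ker A
  have hRne : R ≠ ⊥ := by
    intro h
    apply hne
    have : A = 0 := LinearMap.range_eq_bot.1 h
    ext v
    exact LinearMap.congr_fun this v
  have hRpos : 0 < Module.finrank ℂ R := by
    rw [Module.finrank_pos_iff]
    exact Submodule.nontrivial_iff_ne_bot.2 hRne
  have : Nontrivial K := Submodule.nontrivial_iff_ne_bot.2 hKne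
  have hq : Module.finrank ℂ (F ⧸ R) = Module.finrank ℂ K := by
    have := Submodule.finrank_quotient_add_finrank R
    omega
  let e : (F ⧸ R) ≃ₗ[ℂ] K := LinearEquiv.ofFinrankEq _ _ hq
  let Q : F →L[ℂ] K := LinearMap.toContinuousLinearMap (e.toLinearMap ∘ₗ R.mkQ)
  have hQ : ∀ y, Q y = 0 ↔ y ∈ R := by
    intro y
    simp [Q]
  obtain ⟨pR, hpR⟩ := LinearMap.exists_leftInverse_of_injective R.subtype (by simp)
  obtain ⟨pK, hpK⟩ := LinearMap.exists_leftInverse_of_injective K.subtype (by simp)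
  let PR : F →L[ℂ] R := LinearMap.toContinuousLinearMap pR
  let PK : E →L[ℂ] K := LinearMap.toContinuousLinearMap pK
  have hPR : ∀ y (hy : y ∈ R), PR y = ⟨y, hy⟩ := fun y hy => LinearMap.congr_fun hpR ⟨y, hy⟩
  have hPK : ∀ y (hy : y ∈ K), PK y = ⟨y, hy⟩ := fun y hy => LinearMap.congr_fun hpK ⟨y, hy⟩
  let Θ : E → R × K := fun z => (PR (f z), PK z)
  let Θ' : E →L[ℂ] R × K := (PR.comp (fderiv ℂ f z₀)).prod PK
  have hΘinj : Function.Injective Θ' := by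
    rw [← ContinuousLinearMap.coe_coe, ← LinearMap.ker_eq_bot, LinearMap.ker_eq_bot']
    intro v hv
    have h1 : PR (A v) = 0 := congrArg Prod.fst hv
    have h2 : PK v = 0 := congrArg Prod.snd hv
    have h3 : A v = 0 := by
      rw [hPR _ (LinearMap.mem_range_self A v)] at h1
      exact congrArg Subtype.val h1
    rw [hPK v h3] at h2
    exact congrArg Subtype.val h2
  let L : E ≃ₗ[ℂ] R × K := LinearEquiv.ofInjectiveOfFinrankEq Θ'.toLinearMap hΘinj (by
    rw [Module.finrank_prod, hsum, hE])
  let Lc : E ≃L[ℂ] R × K := L.toContinuousLinearEquiv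
  have hLc : (Lc : E →L[ℂ] R × K) = Θ' := by ext v <;> rfl
  have hCf : ContDiffAt ℂ 1 f z₀ := ((hb_contDiffOn hU hf).contDiffAt (hU.mem_nhds hz₀)).of_le (by
    exact_mod_cast le_top)
  have hCΘ : ContDiffAt ℂ 1 Θ z₀ := 
    (PR.contDiff.contDiffAt.comp z₀ hCf).prodMk PK.contDiff.contDiffAt
  have hDΘ : HasFDerivAt Θ (Lc : E →L[ℂ] R × K) z₀ := by
    rw [hLc]
    exact (PR.hasFDerivAt.comp z₀ (hCf.differentiableAt one_ne_zero).hasFDerivAt).prodMk PK.hasFDerivAt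
  let H := hCΘ.toOpenPartialHomeomorph Θ hDΘ one_ne_zero
  let Ψ := hCΘ.localInverse hDΘ one_ne_zero
  have hΨC : ContDiffAt ℂ 1 Ψ (Θ z₀) := hCΘ.to_localInverse hDΘ one_ne_zero
  have hst := hCΘ.hasStrictFDerivAt' hDΘ one_ne_zero
  have hΨ0 : Ψ (Θ z₀) = z₀ := hst.localInverse_apply_image
  have hΨr : ∀ᶠ y in 𝓝 (Θ z₀), Θ (Ψ y) = y := hst.eventually_right_inverse
  have hΨd : ∀ᶠ y in 𝓝 (Θ z₀), DifferentiableAt ℂ Ψ y := by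
    have := hΨC.eventually (by simp)
    filter_upwards [this] with y hy using hy.differentiableAt one_ne_zero
  have hΨU : ∀ᶠ y in 𝓝 (Θ z₀), Ψ y ∈ U := 
    hΨC.continuousAt.eventually (by rw [hΨ0]; exact hU.mem_nhds hz₀)
  have hall := (hΨr.and (hΨd.and hΨU))
  set a := PR (f z₀) with ha
  set b := PK z₀ with hb
  have hcont : ContinuousAt (fun k : K => (a, k)) b := by fun_prop
  obtain ⟨V, hV, hVo, hbV⟩ := _root_.eventually_nhds_iff.1 (hcont.eventually (p := fun y => _) hall)
  let g : K → K := fun k => Q (f (Ψ (a, k)))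
  have hin : ∀ k, HasFDerivAt (fun k : K => (a, k)) (ContinuousLinearMap.inr ℂ R K) k := by
    intro k
    exact hasFDerivAt_prodMk_right a k
  have hg : ∀ k ∈ V, HasFDerivAt g (Q.comp ((fderiv ℂ f (Ψ (a, k))).comp
      ((fderiv ℂ Ψ (a, k)).comp (ContinuousLinearMap.inr ℂ R K)))) k := by
    intro k hk
    obtain ⟨h1, h2, h3⟩ := hV k hk
    exact Q.hasFDerivAt.comp k ((hf.differentiableAt (hU.mem_nhds h3)).hasFDerivAt.comp k
      (h2.hasFDerivAt.comp k (hin k)))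
  have hginj : InjOn g V := by
    intro k hk k' hk' hkk
    obtain ⟨h1, h2, h3⟩ := hV k hk
    obtain ⟨h1', h2', h3'⟩ := hV k' hk'
    have e1 : PR (f (Ψ (a, k))) = a := congrArg Prod.fst h1
    have e2 : PR (f (Ψ (a, k'))) = a := congrArg Prod.fst h1'
    have hm : f (Ψ (a, k)) - f (Ψ (a, k')) ∈ R := by
      rw [← hQ, map_sub, sub_eq_zero]; exact hkk
    have h4 := hPR _ hm
    rw [map_sub, e1, e2, sub_self] at h4
    have h5 : f (Ψ (a, k)) - f (Ψ (a, k')) = 0 := (congrArg Subtype.val h4).symm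
    have h6 := hinj h3 h3' (sub_eq_zero.1 h5)
    have h7 : ((a, k) : R × K) = (a, k') := by
      rw [← h1, ← h1']; simp only [h6]
    exact congrArg Prod.snd h7
  have hi := IH (Module.finrank ℂ K) (by omega) K K rfl rfl V g hVo
    (fun k hk => (hg k hk).differentiableAt.differentiableWithinAt) hginj b hbV
  rw [(hg b hbV).fderiv] at hi
  obtain ⟨x, hx⟩ := exists_ne (0 : K)
  apply hx
  apply hi
  rw [map_zero]
  have hb0 : Ψ (a, b) = z₀ := hΨ0
  simp only [ContinuousLinearMap.comp_apply, hb0]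
  rw [hQ]
  exact LinearMap.mem_range_self A _

end PartB2

section PartB3

lemma os_det {E F : Type} [NormedAddCommGroup E] [NormedSpace ℂ E]
    [FiniteDimensional ℂ E] [NormedAddCommGroup F] [NormedSpace ℂ F] [FiniteDimensional ℂ F]
    (hEF : Module.finrank ℂ E = Module.finrank ℂ F) {U : Set E} {f : E → F}
    (hU : IsOpen U) (hf : DifferentiableOn ℂ f U) :
    ∃ J : E → ℂ, DifferentiableOn ℂ J U ∧
      ∀ z, J z = 0 ↔ ¬ Function.Injective (fderiv ℂ f z) := by
  have : CompleteSpace F := FiniteDimensional.complete ℂ F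
  let Φ : F ≃L[ℂ] E := ContinuousLinearEquiv.ofFinrankEq hEF.symm
  let b := Module.finBasis ℂ E
  let M : E → (E →ₗ[ℂ] E) := fun z => Φ.toLinearEquiv.toLinearMap ∘ₗ (fderiv ℂ f z).toLinearMap
  refine ⟨fun z => LinearMap.det (M z), ?_, ?_⟩
  · have h1 : ∀ z, LinearMap.det (M z) = (LinearMap.toMatrix b b (M z)).det := fun z => by
      rw [LinearMap.det_toMatrix]
    simp only [h1, Matrix.det_apply]
    apply DifferentiableOn.fun_sum
    intro σ _
    apply DifferentiableOn.const_smul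
    suffices hs : ∀ i, DifferentiableOn ℂ (fun y => LinearMap.toMatrix b b (M y) (σ i) i) U by
      have hi : ∀ u : Finset (Fin (Module.finrank ℂ E)),
          DifferentiableOn ℂ (fun y => ∏ i ∈ u, LinearMap.toMatrix b b (M y) (σ i) i) U := by
        classical
        intro u
        induction u using Finset.induction_on with
        | empty => simp
        | insert a u ha ih =>
          simp only [Finset.prod_insert ha]
          exact (hs a).mul ih
      exact hi _
    intro i
    simp only [LinearMap.toMatrix_apply]
    have h2 := hb_fderiv_apply hU hf (b i)
    let l : F →L[ℂ] ℂ := (LinearMap.toContinuousLinearMap (b.coord (σ i))).comp Φ.toContinuousLinearMap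
    exact l.differentiable.comp_differentiableOn h2
  · intro z
    rw [LinearMap.det_eq_zero_iff_ker_ne_bot, ne_eq, LinearMap.ker_eq_bot]
    refine not_congr ?_
    change Function.Injective (Φ ∘ fderiv ℂ f z) ↔ _
    exact Φ.injective.of_comp_iff _

theorem os_main : ∀ d, OsP d := by
  intro d
  induction d using Nat.strong_induction_on with
  | _ d IH =>
  intro E F _ _ _ _ _ _ hE hF U f hU hf hinj z₀ hz₀
  have : CompleteSpace F := FiniteDimensional.complete ℂ F
  by_contra hni
  have hD0 : fderiv ℂ f z₀ = 0 := os_rank IH hE hF hU hf hinj hz₀ hni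
  rcases Nat.lt_or_ge d 2 with hd | hd
  · interval_cases d
    · have : Subsingleton E := Module.finrank_zero_iff.1 hE
      exact hni (Function.injective_of_subsingleton _)
    · let e : ℂ ≃L[ℂ] E := ContinuousLinearEquiv.ofFinrankEq (by rw [hE, Module.finrank_self])
      let e' : F ≃L[ℂ] ℂ := ContinuousLinearEquiv.ofFinrankEq (by rw [hF, Module.finrank_self])
      have hg : ∀ ζ ∈ e ⁻¹' U, HasFDerivAt (fun ζ => e' (f (e ζ)))
          ((e' : F →L[ℂ] ℂ).comp ((fderiv ℂ f (e ζ)).comp (e : ℂ →L[ℂ] E))) ζ := fun ζ hζ =>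
        e'.hasFDerivAt.comp ζ
          ((hf.differentiableAt (hU.mem_nhds hζ)).hasFDerivAt.comp ζ e.hasFDerivAt)
      have h := os_dim_one (f := fun ζ => e' (f (e ζ))) (U := e ⁻¹' U) (hU.preimage e.continuous)
        (fun ζ hζ => (hg ζ hζ).differentiableAt.differentiableWithinAt)
        (fun x hx y hy hxy => e.injective (hinj hx hy (e'.injective hxy)))
        (z₀ := e.symm z₀) (by simpa using hz₀)
      apply h
      have h2 := hg (e.symm z₀) (by simpa using hz₀)
      rw [e.apply_symm_apply, hD0] at h2
      rw [h2.hasDerivAt.deriv]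
      simp
  · obtain ⟨J, hJ, hJi⟩ := os_det (hE.trans hF.symm) hU hf
    obtain ⟨ρ, hρ, hsub⟩ := Metric.isOpen_iff.1 hU z₀ hz₀
    have hnt : Nontrivial E := Module.nontrivial_of_finrank_pos (R := ℂ) (by omega)
    have hJ0 : J z₀ = 0 := (hJi z₀).2 hni
    have hex : ∃ z₁ ∈ ball z₀ ρ, J z₁ ≠ 0 := by
      by_contra! hcon
      have hz : ∀ z ∈ ball z₀ ρ, fderiv ℂ f z = 0 := fun z hz =>
        os_rank IH hE hF hU hf hinj (hsub hz) ((hJi z).1 (hcon z hz))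
      obtain ⟨x, hx⟩ := exists_ne (0 : E)
      have hxn : 0 < ‖x‖ := norm_pos_iff.2 hx
      set y : E := z₀ + ((ρ / 2 / ‖x‖ : ℝ) : ℂ) • x with hy
      have hyb : y ∈ ball z₀ ρ := by
        rw [mem_ball_iff_norm, hy, add_sub_cancel_left, norm_smul, Complex.norm_real,
          Real.norm_of_nonneg (by positivity), div_mul_cancel₀ _ hxn.ne']
        linarith
      have := isOpen_ball.is_const_of_fderiv_eq_zero (𝕜 := ℂ)
        (convex_ball z₀ ρ).isPreconnected (hf.mono hsub)
        (fun z hz' => hz z hz') hyb (mem_ball_self hρ)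
      have h3 := hinj (hsub hyb) hz₀ this
      rw [hy, add_eq_left, smul_eq_zero] at h3
      rcases h3 with h3 | h3
      · rw [Complex.ofReal_eq_zero] at h3
        exact (by positivity : (ρ / 2 / ‖x‖) ≠ 0) h3
      · exact hx h3
    obtain ⟨z₁, hz₁, hJ1⟩ := hex
    set v := z₁ - z₀ with hv
    have hv0 : v ≠ 0 := fun h => hJ1 (by rw [sub_eq_zero.1 h, hJ0])
    have hw : ∃ w, w ∉ Submodule.span ℂ {v} := by
      by_contra! hcon
      have h1 : Submodule.span ℂ {v} = ⊤ := Submodule.eq_top_iff'.2 hcon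
      have h2 := finrank_span_singleton (K := ℂ) hv0
      rw [h1, finrank_top] at h2
      omega
    obtain ⟨w, hw⟩ := hw
    let P : ℂ × ℂ → E := fun p => z₀ + p.1 • w + p.2 • v
    have hPd : Differentiable ℂ P := by fun_prop
    have hne : ¬ ∀ᶠ ζ in 𝓝 (0 : ℂ), J (P (0, ζ)) = 0 := by
      intro hev
      let ℓ : ℂ → E := fun ζ => z₀ + ζ • v
      have hℓ : ∀ ζ, P (0, ζ) = ℓ ζ := fun ζ => by simp [P, ℓ]
      simp only [hℓ] at hev
      have hℓd : Differentiable ℂ ℓ := by fun_prop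
      have ho : IsOpen (ℓ ⁻¹' ball z₀ ρ) := isOpen_ball.preimage hℓd.continuous
      have hc : Convex ℝ (ℓ ⁻¹' ball z₀ ρ) := by
        have : ℓ ⁻¹' ball z₀ ρ = (fun ζ : ℂ => ζ • v) ⁻¹' ball 0 ρ := by
          ext ζ; simp [ℓ]
        rw [this]
        exact (convex_ball (0 : E) ρ).is_linear_preimage
          ⟨fun x y => add_smul x y v, fun c x => smul_assoc c x v⟩
      have han : AnalyticOnNhd ℂ (fun ζ => J (ℓ ζ)) (ℓ ⁻¹' ball z₀ ρ) := by
        apply DifferentiableOn.analyticOnNhd _ ho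
        exact (hJ.mono hsub).comp hℓd.differentiableOn (fun ζ hζ => hζ)
      have h0m : (0 : ℂ) ∈ ℓ ⁻¹' ball z₀ ρ := by simp [ℓ, hρ]
      have h1m : (1 : ℂ) ∈ ℓ ⁻¹' ball z₀ ρ := by simpa [ℓ, hv] using hz₁
      have := han.eqOn_zero_of_preconnected_of_eventuallyEq_zero hc.isPreconnected h0m hev h1m
      apply hJ1
      simpa [ℓ, hv] using this
    obtain ⟨c₁, γ, K, s, hs, hγ, hγs⟩ := os_zcurve (W := P ⁻¹' U) (J := fun p => J (P p))
      (hU.preimage hPd.continuous) (hJ.comp hPd.differentiableOn (fun _ h => h))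
      (by simpa [P] using hz₀) (by simpa [P] using hJ0) hne
    obtain ⟨r, hr, hrs⟩ := Metric.mem_nhds_iff.1 hs
    let p : ℂ → E := fun c => P (c, γ c)
    have hp : ∀ c ∈ ball c₁ r, HasFDerivAt (fun c => f (p c)) (0 : ℂ →L[ℂ] F) c := by
      intro c hc
      obtain ⟨hcU, hcJ⟩ := hγs c (hrs hc)
      have hD : HasFDerivAt f (0 : E →L[ℂ] F) (p c) := by
        have := (hf.differentiableAt (hU.mem_nhds hcU)).hasFDerivAt
        rwa [os_rank IH hE hF hU hf hinj hcU ((hJi _).1 hcJ)] at this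
      have hbig : (fun c' => p c' - p c) =O[𝓝 c] fun c' => c' - c := by
        apply Asymptotics.IsBigO.of_bound (‖w‖ + K * ‖v‖)
        filter_upwards [isOpen_ball.mem_nhds hc] with c' hc'
        have : p c' - p c = (c' - c) • w + (γ c' - γ c) • v := by
          simp only [p, P]; module
        rw [this]
        refine (norm_add_le _ _).trans ?_
        rw [norm_smul, norm_smul]
        have h1 := hγ.dist_le_mul _ (hrs hc') _ (hrs hc)
        rw [dist_eq_norm, dist_eq_norm] at h1
        nlinarith [mul_le_mul_of_nonneg_right h1 (norm_nonneg v)]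
      have hpc : Tendsto p (𝓝 c) (𝓝 (p c)) := by
        have h1 : Tendsto (fun c' : ℂ => c' - c) (𝓝 c) (𝓝 0) := by
          have : ContinuousAt (fun c' : ℂ => c' - c) c := by fun_prop
          simpa [ContinuousAt] using this
        have h2 := (hbig.trans_tendsto h1).add_const (p c)
        simpa using h2
      rw [hasFDerivAt_iff_isLittleO] at hD ⊢
      have := (hD.comp_tendsto hpc).trans_isBigO hbig
      simpa [Function.comp_def] using this
    set c₂ : ℂ := c₁ + ((r / 2 : ℝ) : ℂ) with hc₂
    have hc₂b : c₂ ∈ ball c₁ r := by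
      rw [mem_ball_iff_norm, hc₂, add_sub_cancel_left, Complex.norm_real,
        Real.norm_of_nonneg (by positivity)]
      linarith
    have hc₁b := mem_ball_self (x := c₁) hr
    have hconst := isOpen_ball.is_const_of_fderiv_eq_zero (𝕜 := ℂ)
        (convex_ball c₁ r).isPreconnected
        (fun c hc => (hp c hc).differentiableAt.differentiableWithinAt)
        (fun c hc => (hp c hc).fderiv) hc₂b hc₁b
    have heq := hinj (hγs c₂ (hrs hc₂b)).1 (hγs c₁ (hrs hc₁b)).1 hconst
    apply hw
    rw [Submodule.mem_span_singleton]
    have h4 : (c₂ - c₁) • w = (γ c₁ - γ c₂) • v := by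
      simp only [P] at heq
      rw [sub_smul, sub_smul, sub_eq_sub_iff_add_eq_add]
      have h5 := congrArg (fun x => x - z₀) heq
      calc c₂ • w + γ c₂ • v = z₀ + c₂ • w + γ c₂ • v - z₀ := by module
        _ = _ := h5
        _ = _ := by module
    have hc0 : c₂ - c₁ ≠ 0 := by
      rw [hc₂, add_sub_cancel_left, ne_eq, Complex.ofReal_eq_zero]
      positivity
    refine ⟨(c₂ - c₁)⁻¹ * (γ c₁ - γ c₂), ?_⟩
    rw [mul_smul, ← h4, smul_smul, inv_mul_cancel₀ hc0, one_smul]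

theorem osgood {n : ℕ} {U : Set (EuclideanSpace ℂ (Fin n))}
    {f : EuclideanSpace ℂ (Fin n) → EuclideanSpace ℂ (Fin n)} (hU : IsOpen U)
    (hf : DifferentiableOn ℂ f U) (hinj : InjOn f U) {z} (hz : z ∈ U) :
    Function.Injective (fderiv ℂ f z) :=
  os_main n _ _ (by simp) (by simp) U f hU hf hinj z hz

end PartB3

section PartC0

variable {n : ℕ}

lemma inv_hasFDeriv {U : Set (En n)} {f : En n → En n} (hU : IsOpen U)
    (hf : DifferentiableOn ℂ f U) (hinj : InjOn f U) {z : En n} (hz : z ∈ U) :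
    DifferentiableAt ℂ (Function.invFunOn f U) (f z) ∧ f '' U ∈ 𝓝 (f z) := by
  have hi := osgood hU hf hinj hz
  let L : En n ≃ₗ[ℂ] En n := LinearEquiv.ofInjectiveOfFinrankEq (fderiv ℂ f z).toLinearMap hi rfl
  let A : En n ≃L[ℂ] En n := L.toContinuousLinearEquiv
  have hst : HasStrictFDerivAt f (A : En n →L[ℂ] En n) z := by
    have h1 := hb_strict hU hf hz
    have h2 : (A : En n →L[ℂ] En n) = fderiv ℂ f z := by ext v; rfl
    rwa [h2]
  have hd := hst.to_localInverse
  have h0 := hst.localInverse_apply_image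
  have hr := hst.eventually_right_inverse
  have hu : ∀ᶠ y in 𝓝 (f z), hst.localInverse f A z y ∈ U :=
    hd.hasFDerivAt.continuousAt.eventually (by rw [h0]; exact hU.mem_nhds hz)
  constructor
  · have he : Function.invFunOn f U =ᶠ[𝓝 (f z)] hst.localInverse f A z := by
      filter_upwards [hr, hu] with y h1 h2
      conv_lhs => rw [← h1]
      exact hinj.leftInvOn_invFunOn h2
    exact (hd.hasFDerivAt.congr_of_eventuallyEq he).differentiableAt
  · filter_upwards [hr, hu] with y h1 h2
    exact ⟨_, h2, h1⟩

lemma isOpen_Ball : IsOpen (Ball n) := isOpen_ball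
lemma zero_mem_Ball : (0 : En n) ∈ Ball n := mem_ball_self one_pos
lemma mem_Ball {z : En n} : z ∈ Ball n ↔ ‖z‖ < 1 := by simp [Ball]

lemma En_fderiv_smul_id {a : ℂ} : ((a • ContinuousLinearMap.id ℂ (En n)) : En n →L[ℂ] En n) = a • ContinuousLinearMap.id ℂ (En n) := rfl

section ev
variable {F : ℝ → En n → En n} (hF : IsNormalizedLoewnerChain n F)
include hF

lemma ev_spec {u v : ℝ} (hu : 0 ≤ u) (huv : u ≤ v) {z : En n} (hz : z ∈ Ball n) :
    evolution n F u v z ∈ Ball n ∧ F v (evolution n F u v z) = F u z :=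
  have h : F u z ∈ F v '' Ball n := hF.1.2.1 u v hu huv (mem_image_of_mem _ hz)
  ⟨Function.invFunOn_mem h, Function.invFunOn_eq h⟩

lemma ev_uniq {u v : ℝ} (hu : 0 ≤ u) (huv : u ≤ v) {z w : En n} (hz : z ∈ Ball n)
    (hw : w ∈ Ball n) (h : F v w = F u z) : evolution n F u v z = w := by
  obtain ⟨h1, h2⟩ := ev_spec hF hu huv hz
  exact (hF.1.1 v (hu.trans huv)).2 h1 hw (h2.trans h.symm)

lemma ev_diff {u v : ℝ} (hu : 0 ≤ u) (huv : u ≤ v) :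
    DifferentiableOn ℂ (evolution n F u v) (Ball n) := by
  intro z hz
  obtain ⟨h1, h2⟩ := ev_spec hF hu huv hz
  have hv := hF.1.1 v (hu.trans huv)
  have h3 := (inv_hasFDeriv isOpen_Ball hv.1 hv.2 h1).1
  rw [h2] at h3
  exact (h3.comp z ((hF.1.1 u hu).1.differentiableAt (isOpen_Ball.mem_nhds hz))).differentiableWithinAt

lemma ev_inj {u v : ℝ} (hu : 0 ≤ u) (huv : u ≤ v) : InjOn (evolution n F u v) (Ball n) := by
  intro z hz w hw h
  apply (hF.1.1 u hu).2 hz hw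
  rw [← (ev_spec hF hu huv hz).2, ← (ev_spec hF hu huv hw).2, h]

lemma ev_zero {u v : ℝ} (hu : 0 ≤ u) (huv : u ≤ v) : evolution n F u v 0 = 0 :=
  ev_uniq hF hu huv zero_mem_Ball zero_mem_Ball (by
    rw [(hF.2 v (hu.trans huv)).1, (hF.2 u hu).1])

lemma ev_fderiv {u v : ℝ} (hu : 0 ≤ u) (huv : u ≤ v) :
    fderiv ℂ (evolution n F u v) 0 = (Real.exp (u - v) : ℂ) • ContinuousLinearMap.id ℂ (En n) := by
  have hd := (ev_diff hF hu huv).differentiableAt (isOpen_Ball.mem_nhds zero_mem_Ball)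
  have hv := (hF.1.1 v (hu.trans huv)).1.differentiableAt (isOpen_Ball.mem_nhds zero_mem_Ball)
  have hv' := hv.hasFDerivAt
  rw [← ev_zero hF hu huv] at hv'
  have hc := hv'.comp 0 hd.hasFDerivAt
  have he : F u =ᶠ[𝓝 0] F v ∘ evolution n F u v := by
    filter_upwards [isOpen_Ball.mem_nhds zero_mem_Ball] with z hz
    exact (ev_spec hF hu huv hz).2.symm
  have h1 := (hc.congr_of_eventuallyEq he).fderiv
  rw [(hF.2 u hu).2, ev_zero hF hu huv, (hF.2 v (hu.trans huv)).2] at h1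
  have hne : (Real.exp v : ℂ) ≠ 0 := by exact_mod_cast (Real.exp_pos v).ne'
  ext1 x
  have h2 := congrArg (fun A : En n →L[ℂ] En n => A x) h1
  simp only [ContinuousLinearMap.smul_apply, ContinuousLinearMap.id_apply,
    ContinuousLinearMap.comp_apply] at h2 ⊢
  rw [Real.exp_sub, Complex.ofReal_div, div_eq_inv_mul, mul_smul, h2, smul_smul,
    inv_mul_cancel₀ hne, one_smul]

lemma ev_comp {u v w : ℝ} (hu : 0 ≤ u) (huv : u ≤ v) (hvw : v ≤ w) {z : En n} (hz : z ∈ Ball n) :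
    evolution n F u w z = evolution n F v w (evolution n F u v z) := by
  obtain ⟨h1, h2⟩ := ev_spec hF hu huv hz
  obtain ⟨h3, h4⟩ := ev_spec hF (hu.trans huv) hvw h1
  exact ev_uniq hF hu (huv.trans hvw) hz h3 (h4.trans h2)

lemma ev_self {u : ℝ} (hu : 0 ≤ u) {z : En n} (hz : z ∈ Ball n) : evolution n F u u z = z :=
  ev_uniq hF hu le_rfl hz hz rfl

lemma ev_norm {u v : ℝ} (hu : 0 ≤ u) (huv : u ≤ v) {z : En n} (hz : z ∈ Ball n) :
    ‖evolution n F u v z‖ ≤ ‖z‖ :=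
  Complex.norm_le_norm_of_mapsTo_ball (ev_diff hF hu huv) 
    (fun w hw => ball_subset_closedBall (ev_spec hF hu huv hw).1) (ev_zero hF hu huv) (mem_Ball.1 hz)
end ev

end PartC0

section PartC1

variable {n : ℕ}

lemma fix_surj {p : En n → En n} {x y : En n} {r : ℝ} {k : NNReal} (hk : k < 1) (hr : 0 ≤ r)
    (hp : LipschitzOnWith k p (closedBall x r)) (hy : ‖x + p x - y‖ ≤ (1 - k) * r) :
    ∃ w ∈ closedBall x r, w + p w = y := by
  have hmaps : MapsTo (fun w => y - p w) (closedBall x r) (closedBall x r) := by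
    intro w hw
    have h1 := hp.dist_le_mul w hw x (mem_closedBall_self hr)
    rw [mem_closedBall_iff_norm] at hw ⊢
    rw [dist_eq_norm, dist_eq_norm] at h1
    have h2 : y - p w - x = -(x + p x - y) - (p w - p x) := by abel
    rw [h2]
    refine (norm_sub_le _ _).trans ?_
    rw [norm_neg]
    nlinarith [k.2]
  have hcon : ContractingWith k (hmaps.restrict (fun w => y - p w) _ _) := by
    refine ⟨hk, LipschitzWith.of_dist_le_mul ?_⟩
    intro a b
    have h1 := hp.dist_le_mul a a.2 b b.2
    rw [Subtype.dist_eq, Subtype.dist_eq]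
    change dist (y - p a) (y - p b) ≤ k * dist (a : En n) b
    rwa [dist_sub_left]
  obtain ⟨w, hw, hfix, -⟩ := hcon.exists_fixedPoint' isClosed_closedBall.isComplete hmaps
    (mem_closedBall_self hr) (edist_ne_top _ _)
  refine ⟨w, hw, ?_⟩
  have : y - p w = w := hfix
  exact (eq_add_of_sub_eq this).symm

lemma bilip {U K : Set (En n)} {f : En n → En n} (hU : IsOpen U)
    (hf : DifferentiableOn ℂ f U) (hinj : InjOn f U) (hK : IsCompact K) (hKU : K ⊆ U) :
    ∃ A : ℝ, 0 ≤ A ∧ ∀ x ∈ K, ∀ y ∈ K, ‖x - y‖ ≤ A * ‖f x - f y‖ := by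
  suffices h : ∃ A : ℝ, 0 ≤ A ∧ ∀ p ∈ K ×ˢ K, ‖p.1 - p.2‖ ≤ A * ‖f p.1 - f p.2‖ by
    obtain ⟨A, hA, h⟩ := h
    exact ⟨A, hA, fun x hx y hy => h (x, y) ⟨hx, hy⟩⟩
  refine (hK.prod hK).induction_on (p := fun S => ∃ A : ℝ, 0 ≤ A ∧ ∀ p ∈ S, 
    ‖p.1 - p.2‖ ≤ A * ‖f p.1 - f p.2‖) ⟨0, le_rfl, by simp⟩ ?_ ?_ ?_
  · rintro S S' hSS ⟨A, hA, h⟩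
    exact ⟨A, hA, fun p hp => h p (hSS hp)⟩
  · rintro S S' ⟨A, hA, h⟩ ⟨A', hA', h'⟩
    refine ⟨max A A', le_max_of_le_left hA, ?_⟩
    rintro p (hp | hp)
    · exact (h p hp).trans (mul_le_mul_of_nonneg_right (le_max_left _ _) (norm_nonneg _))
    · exact (h' p hp).trans (mul_le_mul_of_nonneg_right (le_max_right _ _) (norm_nonneg _))
  · rintro ⟨x, y⟩ ⟨hx, hy⟩
    have hxU := hKU hx
    have hyU := hKU hy
    by_cases hxy : x = y
    · subst hxy
      have hOpen : IsOpen (f '' U) := by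
        rw [isOpen_iff_mem_nhds]
        rintro _ ⟨z, hz, rfl⟩
        exact (inv_hasFDeriv hU hf hinj hz).2
      have hgd : DifferentiableOn ℂ (Function.invFunOn f U) (f '' U) := by
        rintro _ ⟨z, hz, rfl⟩
        exact (inv_hasFDeriv hU hf hinj hz).1.differentiableWithinAt
      obtain ⟨c, s, hs, hl⟩ :=
        (hb_strict hOpen hgd (mem_image_of_mem f hxU)).exists_lipschitzOnWith
      have hfc : ContinuousAt f x := (hf.differentiableAt (hU.mem_nhds hxU)).continuousAt
      have hm : f ⁻¹' s ∩ U ∈ 𝓝 x := inter_mem (hfc hs) (hU.mem_nhds hxU)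
      refine ⟨(f ⁻¹' s ∩ U) ×ˢ (f ⁻¹' s ∩ U), mem_nhdsWithin_of_mem_nhds (prod_mem_nhds hm hm),
        c, c.2, ?_⟩
      rintro ⟨a, b⟩ ⟨ha, hb⟩
      have h1 := hl.dist_le_mul _ ha.1 _ hb.1
      rw [hinj.leftInvOn_invFunOn ha.2, hinj.leftInvOn_invFunOn hb.2, dist_eq_norm,
        dist_eq_norm] at h1
      exact h1
    · have hne : 0 < ‖f x - f y‖ := norm_pos_iff.2 (sub_ne_zero.2 fun h => hxy (hinj hxU hyU h))
      set A := ‖x - y‖ / ‖f x - f y‖ + 1 with hA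
      have hlt : ‖x - y‖ < A * ‖f x - f y‖ := by
        rw [hA, add_mul, div_mul_cancel₀ _ hne.ne']; linarith
      have hfx : ContinuousAt f x := (hf.differentiableAt (hU.mem_nhds hxU)).continuousAt
      have hfy : ContinuousAt f y := (hf.differentiableAt (hU.mem_nhds hyU)).continuousAt
      have hc1 : ContinuousAt (fun p : En n × En n => ‖p.1 - p.2‖) (x, y) := by fun_prop
      have hc2 : ContinuousAt (fun p : En n × En n => A * ‖f p.1 - f p.2‖) (x, y) := by
        have h1 : ContinuousAt (fun p : En n × En n => f p.1) (x, y) :=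
          ContinuousAt.comp (f := Prod.fst) hfx continuousAt_fst
        have h2 : ContinuousAt (fun p : En n × En n => f p.2) (x, y) :=
          ContinuousAt.comp (f := Prod.snd) hfy continuousAt_snd
        exact continuousAt_const.mul (h1.sub h2).norm
      refine ⟨_, mem_nhdsWithin_of_mem_nhds (hc1.eventually_lt hc2 hlt), A, by positivity, ?_⟩
      intro p hp
      exact le_of_lt hp

/-- admissible perturbations -/
structure Adm (n : ℕ) (q : En n → En n) (C : ℝ) : Prop where
  diff : DifferentiableOn ℂ q (Ball n)
  lip : ∀ x ∈ Ball n, ∀ y ∈ Ball n, ‖q x - q y‖ ≤ C * ‖x - y‖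
  zero : q 0 = 0
  der : fderiv ℂ q 0 = 0
  nonneg : 0 ≤ C

section psi
variable {q : En n → En n} {C : ℝ} {ε : ℂ}

def psi (q : En n → En n) (ε : ℂ) : En n → En n := fun z => z + ε • q z

lemma psi_lip (hq : Adm n q C) (hε : ‖ε‖ * C ≤ 1 / 4) :
    LipschitzOnWith (1 / 4) (fun z => ε • q z) (Ball n) := by
  apply LipschitzOnWith.of_dist_le_mul
  intro x hx y hy
  rw [dist_eq_norm, dist_eq_norm, ← smul_sub, norm_smul]
  have := hq.lip x hx y hy
  have h2 := mul_le_mul_of_nonneg_left this (norm_nonneg ε)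
  have h3 := mul_le_mul_of_nonneg_right hε (norm_nonneg (x - y))
  push_cast
  linarith

lemma psi_lip2 (hq : Adm n q C) (hε : ‖ε‖ * C ≤ 1 / 4) {x y : En n} (hx : x ∈ Ball n)
    (hy : y ∈ Ball n) : ‖psi q ε x - psi q ε y‖ ≤ 2 * ‖x - y‖ := by
  have h := (psi_lip hq hε).dist_le_mul x hx y hy
  rw [dist_eq_norm, dist_eq_norm] at h
  push_cast at h
  have h2 : psi q ε x - psi q ε y = (x - y) + (ε • q x - ε • q y) := by
    simp only [psi]; abel
  rw [h2]
  refine (norm_add_le _ _).trans ?_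
  linarith [norm_nonneg (x - y)]

lemma psi_zero (hq : Adm n q C) : psi q ε 0 = 0 := by simp [psi, hq.zero]

lemma psi_bound (hq : Adm n q C) (hε : ‖ε‖ * C ≤ 1 / 4) {x : En n} (hx : x ∈ Ball n) :
    ‖psi q ε x‖ ≤ 2 := by
  have h := psi_lip2 hq hε hx zero_mem_Ball
  rw [psi_zero hq, sub_zero, sub_zero] at h
  have := mem_Ball.1 hx
  linarith

lemma psi_diff (hq : Adm n q C) : DifferentiableOn ℂ (psi q ε) (Ball n) :=
  differentiableOn_id.add (hq.diff.const_smul ε)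

lemma psi_inj (hq : Adm n q C) (hε : ‖ε‖ * C ≤ 1 / 4) : InjOn (psi q ε) (Ball n) := by
  intro x hx y hy hxy
  have h := (psi_lip hq hε).dist_le_mul x hx y hy
  rw [dist_eq_norm, dist_eq_norm] at h
  push_cast at h
  simp only [psi] at hxy
  have h2 : ε • q x - ε • q y = y - x := by
    rw [sub_eq_sub_iff_add_eq_add, add_comm, hxy, add_comm]
  rw [h2, norm_sub_rev y x] at h
  have : ‖x - y‖ = 0 := by linarith [norm_nonneg (x - y)]
  exact sub_eq_zero.1 (norm_eq_zero.1 this)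

lemma psi_fderiv (hq : Adm n q C) : HasFDerivAt (psi q ε) (ContinuousLinearMap.id ℂ (En n)) 0 := by
  have h1 := (hq.diff.differentiableAt (isOpen_Ball.mem_nhds zero_mem_Ball)).hasFDerivAt
  rw [hq.der] at h1
  have h2 := (hasFDerivAt_id (𝕜 := ℂ) (0 : En n)).add (h1.const_smul ε)
  rw [smul_zero, add_zero] at h2
  exact h2

lemma psi_star (hq : Adm n q C) (hε : ‖ε‖ * C ≤ 1 / 4) {z : En n} (hz : z ∈ Ball n) {l : ℝ}
    (hl0 : 0 ≤ l) (hl1 : l ≤ 1) : ∃ w ∈ Ball n, psi q ε w = (l : ℂ) • psi q ε z := by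
  have hz' := mem_Ball.1 hz
  have hlz : ‖(l : ℂ) • z‖ = l * ‖z‖ := by
    rw [norm_smul, Complex.norm_real, Real.norm_of_nonneg hl0]
  have hsub : closedBall ((l : ℂ) • z) ((1 - l) * ‖z‖) ⊆ Ball n := by
    intro w hw
    rw [mem_closedBall_iff_norm] at hw
    rw [mem_Ball]
    have := norm_add_le (w - (l : ℂ) • z) ((l : ℂ) • z)
    rw [sub_add_cancel] at this
    nlinarith
  have hr : 0 ≤ (1 - l) * ‖z‖ := mul_nonneg (by linarith) (norm_nonneg _)
  have hlzB : (l : ℂ) • z ∈ Ball n := hsub (mem_closedBall_self hr)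
  obtain ⟨w, hw, hw'⟩ := fix_surj (p := fun z => ε • q z) (x := (l : ℂ) • z)
    (y := (l : ℂ) • psi q ε z) (r := (1 - l) * ‖z‖) (k := 1 / 4) (by
      rw [← NNReal.coe_lt_coe]; push_cast; norm_num) hr ((psi_lip hq hε).mono hsub) (by
      have h1 : (l : ℂ) • z + ε • q ((l : ℂ) • z) - (l : ℂ) • psi q ε z
          = ε • ((q ((l : ℂ) • z) - q z) + ((1 - l : ℝ) : ℂ) • (q z - q 0)) := by
        simp only [psi, hq.zero]; push_cast; module
      rw [h1, norm_smul]
      have h2 := hq.lip _ hlzB z hz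
      have h3 := hq.lip z hz 0 zero_mem_Ball
      rw [sub_zero] at h3
      have h4 : (l : ℂ) • z - z = (((l - 1 : ℝ)) : ℂ) • z := by push_cast; module
      rw [h4, norm_smul, Complex.norm_real, Real.norm_of_nonpos (by linarith)] at h2
      have h5 : ‖(((1 - l : ℝ)) : ℂ) • (q z - q 0)‖ ≤ (1 - l) * (C * ‖z‖) := by
        rw [norm_smul, Complex.norm_real, Real.norm_of_nonneg (by linarith)]
        exact mul_le_mul_of_nonneg_left h3 (by linarith)
      have h6 : ‖(q ((l : ℂ) • z) - q z) + ((1 - l : ℝ) : ℂ) • (q z - q 0)‖ ≤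
          2 * C * ((1 - l) * ‖z‖) := by
        refine (norm_add_le _ _).trans ?_
        linarith
      have h7 := mul_le_mul_of_nonneg_left h6 (norm_nonneg ε)
      have h8 := mul_le_mul_of_nonneg_right hε hr
      have h9 : (((1 / 4 : NNReal)) : ℝ) = 1 / 4 := by push_cast; rfl
      rw [h9]
      linarith)
  exact ⟨w, hsub hw, hw'⟩
end psi

end PartC1

section PartC2

variable {n : ℕ}

lemma exists_r {K : Set (En n)} (hK : IsCompact K) (hKB : K ⊆ Ball n) :
    ∃ r, 0 < r ∧ r < 1 ∧ K ⊆ closedBall 0 r := by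
  rcases K.eq_empty_or_nonempty with rfl | hne
  · exact ⟨1 / 2, by norm_num, by norm_num, by simp⟩
  · obtain ⟨x, hx, hmax⟩ := hK.exists_isMaxOn hne continuous_norm.continuousOn
    have hx1 := mem_Ball.1 (hKB hx)
    refine ⟨(1 + ‖x‖) / 2, by positivity, by linarith, ?_⟩
    intro y hy
    rw [mem_closedBall_zero_iff]
    have : ‖y‖ ≤ ‖x‖ := hmax hy
    linarith

lemma closedBall_sub_Ball {r : ℝ} (hr : r < 1) : closedBall (0 : En n) r ⊆ Ball n :=
  closedBall_subset_ball hr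

noncomputable def Gch (n : ℕ) (F : ℝ → En n → En n) (s t : ℝ) (ψ : En n → En n) : ℝ → En n → En n :=
  fun u => if u ≤ t - s then fun z => (Real.exp (t - s) : ℂ) • ψ (evolution n F (s + u) t z)
    else fun z => (Real.exp u : ℂ) • ψ z

lemma Gch_form {F : ℝ → En n → En n} (hF : IsNormalizedLoewnerChain n F) {s t : ℝ} (hs : 0 ≤ s)
    {u : ℝ} (hu : 0 ≤ u) {ψ : En n → En n} {z : En n} (hz : z ∈ Ball n) :
    ∃ x ∈ Ball n, Gch n F s t ψ u z = (Real.exp (max u (t - s)) : ℂ) • ψ x := by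
  unfold Gch
  split_ifs with h
  · refine ⟨_, (ev_spec hF (by linarith : 0 ≤ s + u) (by linarith : s + u ≤ t) hz).1, ?_⟩
    rw [max_eq_right h]
  · refine ⟨z, hz, ?_⟩
    rw [max_eq_left (by linarith)]

section chain
variable {F : ℝ → En n → En n} (hF : IsNormalizedLoewnerChain n F) {s t : ℝ} (hs : 0 ≤ s)
  (hst : s ≤ t) {q : En n → En n} {C : ℝ} {ε : ℂ} (hq : Adm n q C) (hε : ‖ε‖ * C ≤ 1 / 4)
include hF hs hst hq hε

lemma Gch_univ {u : ℝ} (hu : 0 ≤ u) : UnivalentOn n (Gch n F s t (psi q ε) u) := by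
  have hpos : ∀ a : ℝ, (Real.exp a : ℂ) ≠ 0 := fun a => by exact_mod_cast (Real.exp_pos a).ne'
  unfold Gch
  split_ifs with h
  · have hsu : 0 ≤ s + u := by linarith
    have hsut : s + u ≤ t := by linarith
    refine ⟨((psi_diff (ε := ε) hq).comp (ev_diff hF hsu hsut)
      (fun z hz => (ev_spec hF hsu hsut hz).1)).const_smul (Real.exp (t - s) : ℂ), ?_⟩
    intro z hz w hw hzw
    have h1 := smul_right_injective _ (hpos _) hzw
    exact ev_inj hF hsu hsut hz hw
      (psi_inj hq hε (ev_spec hF hsu hsut hz).1 (ev_spec hF hsu hsut hw).1 h1)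
  · refine ⟨(psi_diff (ε := ε) hq).const_smul (Real.exp u : ℂ), ?_⟩
    intro z hz w hw hzw
    exact psi_inj hq hε hz hw (smul_right_injective _ (hpos _) hzw)

lemma Gch_norm {u : ℝ} (hu : 0 ≤ u) : Gch n F s t (psi q ε) u 0 = 0 ∧
    fderiv ℂ (Gch n F s t (psi q ε) u) 0 = (Real.exp u : ℂ) • ContinuousLinearMap.id ℂ (En n) := by
  unfold Gch
  split_ifs with h
  · have hsu : 0 ≤ s + u := by linarith
    have hsut : s + u ≤ t := by linarith
    constructor
    · simp only [ev_zero hF hsu hsut, psi_zero hq, smul_zero]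
    · have h1 := ((ev_diff hF hsu hsut).differentiableAt
        (isOpen_Ball.mem_nhds zero_mem_Ball)).hasFDerivAt
      rw [ev_fderiv hF hsu hsut] at h1
      have h2 := psi_fderiv (ε := ε) hq
      rw [← ev_zero hF hsu hsut] at h2
      have h3 := ((h2.comp 0 h1).const_smul (Real.exp (t - s) : ℂ)).fderiv
      refine h3.trans ?_
      rw [ContinuousLinearMap.id_comp, smul_smul, ← Complex.ofReal_mul, ← Real.exp_add]
      congr 3
      ring
  · constructor
    · simp only [psi_zero hq, smul_zero]
    · exact ((psi_fderiv (ε := ε) hq).const_smul (Real.exp u : ℂ)).fderiv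

lemma Gch_mono {u v : ℝ} (hu : 0 ≤ u) (huv : u ≤ v) :
    Gch n F s t (psi q ε) u '' Ball n ⊆ Gch n F s t (psi q ε) v '' Ball n := by
  rintro _ ⟨z, hz, rfl⟩
  by_cases hv : v ≤ t - s
  · have hsu : 0 ≤ s + u := by linarith
    have huv' : s + u ≤ s + v := by linarith
    refine ⟨_, (ev_spec hF hsu huv' hz).1, ?_⟩
    unfold Gch
    rw [if_pos hv, if_pos (huv.trans hv)]
    rw [← ev_comp hF hsu huv' (by linarith) hz]
  · obtain ⟨x, hx, hxe⟩ := Gch_form hF hs hu (ψ := psi q ε) hz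
    have hle : max u (t - s) ≤ v := max_le huv (by linarith)
    obtain ⟨w, hw, hwe⟩ := psi_star hq hε hx (Real.exp_pos (max u (t - s) - v)).le
      (Real.exp_le_one_iff.2 (by linarith))
    refine ⟨w, hw, ?_⟩
    rw [hxe]
    unfold Gch
    rw [if_neg hv]
    rw [hwe, smul_smul, ← Complex.ofReal_mul, ← Real.exp_add, add_sub_cancel]

lemma Gch_normal : IsNormalFamilyChain n (Gch n F s t (psi q ε)) := by
  intro K hKB _
  refine ⟨2 * Real.exp (t - s), ?_⟩
  intro u hu z hz
  obtain ⟨x, hx, hxe⟩ := Gch_form hF hs hu (ψ := psi q ε) (hKB hz)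
  rw [hxe, norm_smul, Complex.norm_real, Real.norm_of_nonneg (Real.exp_pos _).le, ← mul_assoc,
    ← Real.exp_add, mul_comm]
  apply mul_le_mul (psi_bound hq hε hx) _ (Real.exp_pos _).le (by norm_num)
  apply Real.exp_le_exp.2
  have : max u (t - s) ≤ u + (t - s) := max_le (by linarith) (by linarith)
  linarith

lemma Gch_ac {K : Set (En n)} (hKB : K ⊆ Ball n) (hK : IsCompact K) {T' : ℝ} (hT' : 0 < T') :
    ∃ c : ℝ → ℝ, (∀ τ, 0 ≤ c τ) ∧ IntegrableOn c (Set.Icc 0 T') ∧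
      ∀ z ∈ K, ∀ u v : ℝ, 0 ≤ u → u ≤ v → v ≤ T' →
        ‖Gch n F s t (psi q ε) u z - Gch n F s t (psi q ε) v z‖ ≤ ∫ τ in Set.Icc u v, c τ := by
  obtain ⟨r, hr0, hr1, hKr⟩ := exists_r hK hKB
  have hTt : 0 ≤ t - s := by linarith
  have ht : 0 ≤ t := hs.trans hst
  obtain ⟨A, hA, hbi⟩ := bilip isOpen_Ball (hF.1.1 t ht).1 (hF.1.1 t ht).2
    (isCompact_closedBall (0 : En n) r) (closedBall_sub_Ball hr1)
  obtain ⟨c₀, hc0, hci, hc⟩ := hF.1.2.2 K hKB hK (s + T' + t) (by linarith)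
  set B := 2 * Real.exp (t - s) * A with hB
  have hB0 : 0 ≤ B := by positivity
  set D := 2 * Real.exp T' with hD
  have hD0 : 0 ≤ D := by positivity
  have hintg : ∀ u v, 0 ≤ u → u ≤ v → v ≤ T' →
      IntervalIntegrable (fun τ => c₀ (s + τ)) volume u v := by
    intro u v hu huv hv
    have h1 : IntervalIntegrable c₀ volume (s + u) (s + v) := by
      rw [intervalIntegrable_iff_integrableOn_Icc_of_le (by linarith)]
      exact hci.mono_set (Icc_subset_Icc (by linarith) (by linarith))
    have := h1.comp_add_left s
    simpa using this
  have hintgc : ∀ u v, 0 ≤ u → u ≤ v → v ≤ T' →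
      IntervalIntegrable (fun τ => B * c₀ (s + τ) + D) volume u v := fun u v hu huv hv =>
    ((hintg u v hu huv hv).const_mul B).add intervalIntegrable_const
  have hval : ∀ u v, 0 ≤ u → u ≤ v → v ≤ T' → ∫ τ in u..v, (B * c₀ (s + τ) + D) =
      B * (∫ τ in Icc (s + u) (s + v), c₀ τ) + D * (v - u) := by
    intro u v hu huv hv
    rw [intervalIntegral.integral_add ((hintg u v hu huv hv).const_mul B) intervalIntegrable_const,
      intervalIntegral.integral_const_mul, intervalIntegral.integral_comp_add_left c₀ s,
      intervalIntegral.integral_of_le (by linarith), integral_Icc_eq_integral_Ioc,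
      intervalIntegral.integral_const, smul_eq_mul, mul_comm D]
  have hnn : ∀ a b, 0 ≤ ∫ τ in Icc a b, c₀ τ := fun a b => integral_nonneg fun τ => hc0 τ
  have hGT : ∀ u z, z ∈ Ball n → t - s ≤ u → Gch n F s t (psi q ε) u z = (Real.exp u : ℂ) • psi q ε z := by
    intro u z hz hu
    unfold Gch
    split_ifs with h
    · have : u = t - s := le_antisymm h hu
      subst this
      simp only
      rw [add_sub_cancel, ev_self hF ht hz]
    · rfl
  have claimA : ∀ z ∈ K, ∀ u v, 0 ≤ u → u ≤ v → v ≤ T' → v ≤ t - s →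
      ‖Gch n F s t (psi q ε) u z - Gch n F s t (psi q ε) v z‖ ≤ ∫ τ in u..v, (B * c₀ (s + τ) + D) := by
    intro z hz u v hu huv hv hvt
    rw [hval u v hu huv hv]
    have hzB := hKB hz
    have hsu : 0 ≤ s + u := by linarith
    have hsv : 0 ≤ s + v := by linarith
    have hsut : s + u ≤ t := by linarith
    have hsvt : s + v ≤ t := by linarith
    obtain ⟨e1, e2⟩ := ev_spec hF hsu hsut hzB
    obtain ⟨e3, e4⟩ := ev_spec hF hsv hsvt hzB
    have hzr : ‖z‖ ≤ r := by simpa using hKr hz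
    have h1 := hbi (evolution n F (s + u) t z) (by
      rw [mem_closedBall_zero_iff]; exact (ev_norm hF hsu hsut hzB).trans hzr)
      (evolution n F (s + v) t z) (by
      rw [mem_closedBall_zero_iff]; exact (ev_norm hF hsv hsvt hzB).trans hzr)
    rw [e2, e4] at h1
    have h2 := hc z hz (s + u) (s + v) hsu (by linarith) (by linarith)
    have h3 := psi_lip2 hq hε e1 e3
    unfold Gch
    rw [if_pos hvt, if_pos (huv.trans hvt)]
    rw [← smul_sub, norm_smul, Complex.norm_real, Real.norm_of_nonneg (Real.exp_pos _).le]
    have h4 := mul_le_mul_of_nonneg_left h2 hA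
    have h5 : ‖psi q ε (evolution n F (s + u) t z) - psi q ε (evolution n F (s + v) t z)‖ ≤
      2 * (A * ∫ τ in Icc (s + u) (s + v), c₀ τ) := by linarith
    have h6 := mul_le_mul_of_nonneg_left h5 (Real.exp_pos (t - s)).le
    have h7 : 0 ≤ D * (v - u) := mul_nonneg hD0 (by linarith)
    rw [hB]
    linarith
  have claimB : ∀ z ∈ K, ∀ u v, 0 ≤ u → u ≤ v → v ≤ T' → t - s ≤ u →
      ‖Gch n F s t (psi q ε) u z - Gch n F s t (psi q ε) v z‖ ≤ ∫ τ in u..v, (B * c₀ (s + τ) + D) := by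
    intro z hz u v hu huv hv hut
    rw [hval u v hu huv hv, hGT u z (hKB hz) hut, hGT v z (hKB hz) (hut.trans huv), ← sub_smul,
      norm_smul, ← Complex.ofReal_sub, Complex.norm_real, Real.norm_of_nonpos (by
        have := Real.exp_le_exp.2 huv; linarith)]
    have h1 := psi_bound hq hε (hKB hz)
    have h2 : Real.exp v - Real.exp u ≤ Real.exp T' * (v - u) := by
      have h3 := Real.add_one_le_exp (u - v)
      have h4 : Real.exp u = Real.exp v * Real.exp (u - v) := by rw [← Real.exp_add]; congr 1; ring
      have h5 := Real.exp_le_exp.2 hv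
      have h6 := mul_le_mul_of_nonneg_left h3 (Real.exp_pos v).le
      have h7 := mul_le_mul_of_nonneg_right h5 (by linarith : 0 ≤ v - u)
      rw [h4]
      nlinarith
    have h8 : 0 ≤ Real.exp v - Real.exp u := by have := Real.exp_le_exp.2 huv; linarith
    have h9 : -(Real.exp u - Real.exp v) * ‖psi q ε z‖ ≤ (Real.exp v - Real.exp u) * 2 := by
      rw [neg_sub]
      exact mul_le_mul_of_nonneg_left h1 h8
    have h10 := mul_nonneg hB0 (hnn (s + u) (s + v))
    rw [hD]
    linarith
  refine ⟨fun τ => B * c₀ (s + τ) + D, fun τ => by have := mul_nonneg hB0 (hc0 (s + τ)); linarith,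
    ?_, ?_⟩
  · exact (intervalIntegrable_iff_integrableOn_Icc_of_le hT'.le).1 (hintgc 0 T' le_rfl hT'.le le_rfl)
  · intro z hz u v hu huv hv
    rw [integral_Icc_eq_integral_Ioc, ← intervalIntegral.integral_of_le huv]
    rcases le_total v (t - s) with h1 | h1
    · exact claimA z hz u v hu huv hv h1
    · rcases le_total (t - s) u with h2 | h2
      · exact claimB z hz u v hu huv hv h2
      · have h3 := claimA z hz u (t - s) hu h2 (h1.trans hv) le_rfl
        have h4 := claimB z hz (t - s) v hTt h1 hv le_rfl
        rw [← intervalIntegral.integral_add_adjacent_intervals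
          (hintgc u (t - s) hu h2 (h1.trans hv)) (hintgc (t - s) v hTt h1 hv)]
        refine (norm_sub_le_norm_sub_add_norm_sub _ (Gch n F s t (psi q ε) (t - s) z) _).trans ?_
        linarith

theorem memS0_pert : MemS0 n (fun z => (Real.exp (t - s) : ℂ) • 
    (evolution n F s t z + ε • q (evolution n F s t z))) := by
  have h0 : Gch n F s t (psi q ε) 0 = fun z => (Real.exp (t - s) : ℂ) • 
    (evolution n F s t z + ε • q (evolution n F s t z)) := by
    unfold Gch
    rw [if_pos (by linarith)]
    simp only [add_zero, psi]
  rw [← h0]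
  refine ⟨⟨Gch_univ hF hs hst hq hε le_rfl, (Gch_norm hF hs hst hq hε le_rfl).1, ?_⟩,
    Gch n F s t (psi q ε), ⟨⟨fun u hu => Gch_univ hF hs hst hq hε hu,
      fun u v hu huv => Gch_mono hF hs hst hq hε hu huv,
      fun K hKB hK T' hT' => Gch_ac hF hs hst hq hε hKB hK hT'⟩,
      fun u hu => Gch_norm hF hs hst hq hε hu⟩, Gch_normal hF hs hst hq hε, rfl⟩
  rw [(Gch_norm hF hs hst hq hε le_rfl).2]
  simp
end chain

end PartC2

section PartD1

variable {n : ℕ}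

lemma poly_adm {q : En n → En n} (hq : ContDiff ℂ 1 q) (h0 : q 0 = 0) (h1 : fderiv ℂ q 0 = 0) :
    ∃ C, Adm n q C := by
  obtain ⟨C, hC⟩ := (isCompact_closedBall (0 : En n) 1).exists_bound_of_continuousOn
    (hq.continuous_fderiv one_ne_zero).continuousOn
  have hd := hq.differentiable one_ne_zero
  refine ⟨C, hd.differentiableOn, ?_, h0, h1, (norm_nonneg _).trans (hC 0 (by simp))⟩
  intro x hx y hy
  exact (convex_ball (0 : En n) 1).norm_image_sub_le_of_norm_fderiv_le (fun z _ => hd z)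
    (fun z hz => hC z (ball_subset_closedBall hz)) hy hx

noncomputable def homP (f : En n → En n) (k : ℕ) : En n → En n :=
  fun z => ((k.factorial : ℂ))⁻¹ • iteratedFDeriv ℂ k f 0 (fun _ => z)

lemma homP_contDiff (f : En n → En n) (k : ℕ) : ContDiff ℂ 1 (homP f k) := by
  unfold homP
  apply ContDiff.const_smul
  exact (ContinuousMultilinearMap.contDiff _).comp (contDiff_pi.2 fun _ => contDiff_id)

lemma homP_zero {f : En n → En n} (h0 : f 0 = 0) (k : ℕ) : homP f k 0 = 0 := by
  unfold homP
  cases k with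
  | zero => simp [h0]
  | succ k =>
    rw [(iteratedFDeriv ℂ (k + 1) f 0).map_coord_zero 0 rfl, smul_zero]

lemma homP_fderiv {f : En n → En n} (h0 : f 0 = 0) (h1 : fderiv ℂ f 0 = 0) (k : ℕ) :
    HasFDerivAt (homP f k) (0 : En n →L[ℂ] En n) 0 := by
  match k with
  | 0 =>
    have : homP f 0 = fun _ => 0 := by
      funext z; simp [homP, h0]
    rw [this]; exact hasFDerivAt_const _ _
  | 1 =>
    have : homP f 1 = fun _ => 0 := by
      funext z; simp [homP, iteratedFDeriv_one_apply, h1]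
    rw [this]; exact hasFDerivAt_const _ _
  | k + 2 =>
    apply Asymptotics.IsBigO.hasFDerivAt (n := k + 2) _ (by omega)
    apply Asymptotics.IsBigO.of_bound
      (‖(((k + 2).factorial : ℂ))⁻¹‖ * ‖iteratedFDeriv ℂ (k + 2) f 0‖)
    filter_upwards with z
    unfold homP
    rw [norm_smul, sub_zero, norm_pow, norm_norm, mul_assoc]
    apply mul_le_mul_of_nonneg_left _ (norm_nonneg _)
    have := (iteratedFDeriv ℂ (k + 2) f 0).le_opNorm (fun _ => z)
    simpa using this

lemma homP_slice {f : En n → En n} {R : ℝ} (hR : 0 < R) (hf : DifferentiableOn ℂ f (ball 0 R))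
    (z : En n) (k : ℕ) : ((k.factorial : ℂ))⁻¹ • iteratedDeriv k (fun ζ : ℂ => f (ζ • z)) 0 = homP f k z := by
  unfold homP
  congr 1
  let g : ℂ →L[ℂ] En n := ContinuousLinearMap.toSpanSingleton ℂ z
  have hg0 : g 0 = 0 := map_zero g
  have ho : IsOpen (g ⁻¹' ball 0 R) := isOpen_ball.preimage g.continuous
  have h1 := g.iteratedFDerivWithin_comp_right (hb_contDiffOn isOpen_ball hf)
    isOpen_ball.uniqueDiffOn ho.uniqueDiffOn (x := 0) (by rw [hg0]; exact mem_ball_self hR)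
    (i := k) (by exact_mod_cast le_top)
  rw [iteratedFDerivWithin_of_isOpen k ho (by simp [hR]),
    iteratedFDerivWithin_of_isOpen k isOpen_ball (by simp [hR])] at h1
  rw [iteratedDeriv_eq_iteratedFDeriv]
  have h2 : (fun ζ : ℂ => f (ζ • z)) = f ∘ g := by
    funext ζ; simp [g]
  rw [h2, h1, hg0]
  simp [g]

lemma taylor_approx {f : En n → En n} {r R δ : ℝ} (hr : 0 < r) (hrR : r < R) (hδ : 0 < δ)
    (hf : DifferentiableOn ℂ f (ball 0 R)) (h0 : f 0 = 0) (h1 : fderiv ℂ f 0 = 0) :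
    ∃ q C, Adm n q C ∧ ∀ z ∈ closedBall 0 r, ‖f z - q z‖ ≤ δ := by
  obtain ⟨ρ, hrρ, hρR⟩ := exists_between hrR
  have hR : 0 < R := hr.trans hrR
  obtain ⟨M, hM⟩ := (isCompact_closedBall (0 : En n) ρ).exists_bound_of_continuousOn
    (hf.continuousOn.mono (closedBall_subset_ball hρR))
  set β := ρ / r with hβ
  have hβ1 : 1 < β := (one_lt_div hr).2 hrρ
  have hβi : β⁻¹ < 1 := inv_lt_one_of_one_lt₀ hβ1
  have hβ0 : 0 < β := by linarith
  have hlim : Tendsto (fun N : ℕ => M * β⁻¹ ^ N / (1 - β⁻¹)) atTop (𝓝 (M * 0 / (1 - β⁻¹))) :=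
    ((tendsto_pow_atTop_nhds_zero_of_lt_one (by positivity) hβi).const_mul M).div_const _
  rw [mul_zero, zero_div] at hlim
  obtain ⟨N, hN⟩ := (hlim.eventually (gt_mem_nhds hδ)).exists
  have hsd : ContDiff ℂ 1 (fun z => ∑ k ∈ Finset.range N, homP f k z) :=
    ContDiff.sum fun k _ => homP_contDiff f k
  have hder : HasFDerivAt (fun z => ∑ k ∈ Finset.range N, homP f k z) (0 : En n →L[ℂ] En n) 0 := by
    have := HasFDerivAt.fun_sum (u := Finset.range N) (A := fun k => homP f k)
      (A' := fun _ => (0 : En n →L[ℂ] En n)) (x := (0 : En n)) (𝕜 := ℂ)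
      (fun k _ => homP_fderiv h0 h1 k)
    simpa using this
  obtain ⟨C, hC⟩ := poly_adm hsd (Finset.sum_eq_zero fun k _ => homP_zero h0 k) hder.fderiv
  refine ⟨_, C, hC, ?_⟩
  intro z hz
  rw [mem_closedBall_zero_iff] at hz
  have hzR : ∀ ζ : ℂ, ‖ζ‖ ≤ β → ‖ζ • z‖ ≤ ρ := by
    intro ζ hζ
    rw [norm_smul]
    calc ‖ζ‖ * ‖z‖ ≤ β * r := mul_le_mul hζ hz (norm_nonneg _) hβ0.le
      _ = ρ := div_mul_cancel₀ _ hr.ne'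
  have hgd : DifferentiableOn ℂ (fun ζ : ℂ => f (ζ • z)) (closedBall 0 β) := by
    apply hf.comp (by fun_prop)
    intro ζ hζ
    rw [mem_ball_zero_iff]
    exact (hzR ζ (by simpa using hζ)).trans_lt hρR
  have hsum := Complex.hasSum_taylorSeries_on_ball (hgd.mono ball_subset_closedBall)
    (z := 1) (by simpa using hβ1)
  simp only [sub_zero, one_pow, one_smul] at hsum
  simp only [homP_slice hR hf] at hsum
  have hb : ∀ k, ‖homP f k z‖ ≤ M * β⁻¹ ^ k := by
    intro k
    rw [← homP_slice hR hf]
    have h2 := Complex.norm_iteratedDeriv_le_of_forall_mem_sphere_norm_le (C := M) k hβ0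
      ((hgd.diffContOnCl_ball (subset_rfl)))
      (fun ζ hζ => hM _ (by
        rw [mem_closedBall_zero_iff]
        exact hzR ζ (by rw [mem_sphere_zero_iff_norm] at hζ; exact hζ.le)))
    rw [norm_smul, norm_inv, Complex.norm_natCast]
    have hk : (0 : ℝ) < k.factorial := by exact_mod_cast k.factorial_pos
    rw [inv_mul_le_iff₀ hk]
    refine h2.trans (le_of_eq ?_)
    rw [inv_pow]
    field_simp
  have h3 := norm_sub_le_of_geometric_bound_of_hasSum hβi hb hsum N
  rw [norm_sub_rev]
  exact h3.trans hN.le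

end PartD1

section PartD2

variable {n : ℕ}

/-- normalised self maps of the ball -/
structure Slf (n : ℕ) (φ : En n → En n) (a : ℝ) : Prop where
  diff : DifferentiableOn ℂ φ (Ball n)
  maps : MapsTo φ (Ball n) (Ball n)
  zero : φ 0 = 0
  der : fderiv ℂ φ 0 = (a : ℂ) • ContinuousLinearMap.id ℂ (En n)

lemma near_id {φ : En n → En n} {a η r : ℝ} (hφ : Slf n φ a) (hη : 0 < η) (ha : 1 - η ≤ a)
    (ha1 : a ≤ 1) (hr : r < 1) {z : En n} (hz : ‖z‖ ≤ r) : ‖φ z - z‖ ^ 2 ≤ 8 * η / (1 - r) := by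
  have h1r : 0 < 1 - r := by linarith
  by_cases hz0 : z = 0
  · subst hz0
    rw [hφ.zero, sub_zero, norm_zero, zero_pow two_ne_zero]
    positivity
  have hzn : 0 < ‖z‖ := norm_pos_iff.2 hz0
  set v : En n := ((‖z‖⁻¹ : ℝ) : ℂ) • z with hv
  have hvn : ‖v‖ = 1 := by
    rw [hv, norm_smul, Complex.norm_real, Real.norm_of_nonneg (by positivity),
      inv_mul_cancel₀ hzn.ne']
  have hzv : ((‖z‖ : ℝ) : ℂ) • v = z := by
    rw [hv, smul_smul, ← Complex.ofReal_mul, mul_inv_cancel₀ hzn.ne', Complex.ofReal_one, one_smul]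
  let g : ℂ → En n := fun ζ => φ (ζ • v)
  have hmB : ∀ ζ ∈ ball (0 : ℂ) 1, ζ • v ∈ Ball n := by
    intro ζ hζ
    rw [mem_Ball, norm_smul, hvn, mul_one]
    simpa using hζ
  have hgd : DifferentiableOn ℂ g (ball 0 1) := hφ.diff.comp (by fun_prop) hmB
  have hg0 : g 0 = 0 := by simp [g, hφ.zero]
  have hgm : MapsTo g (ball 0 1) (closedBall (g 0) 1) := by
    intro ζ hζ
    rw [hg0]
    exact ball_subset_closedBall (hφ.maps (hmB ζ hζ))
  let ψ : ℂ → En n := dslope g 0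
  have hψn : ∀ ζ ∈ ball (0 : ℂ) 1, ‖ψ ζ‖ ≤ 1 := by
    intro ζ hζ
    have := Complex.norm_dslope_le_div_of_mapsTo_ball hgd hgm hζ
    simpa using this
  have hψd : DifferentiableOn ℂ ψ (ball 0 1) :=
    (Complex.differentiableOn_dslope (ball_mem_nhds 0 one_pos)).2 hgd
  have hψ0 : ψ 0 = (a : ℂ) • v := by
    have h1 : HasFDerivAt φ ((a : ℂ) • ContinuousLinearMap.id ℂ (En n)) ((0 : ℂ) • v) := by
      rw [zero_smul, ← hφ.der]
      exact (hφ.diff.differentiableAt (isOpen_Ball.mem_nhds zero_mem_Ball)).hasFDerivAt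
    have h2 : HasDerivAt (fun ζ : ℂ => ζ • v) v 0 := by
      simpa using (hasDerivAt_id (0 : ℂ)).smul_const v
    have h3 := h1.comp_hasDerivAt (0 : ℂ) h2
    simp only [ψ, dslope_same]
    rw [show deriv g 0 = _ from h3.deriv]
    simp
  let p : ℂ → ℂ := fun ζ => inner ℂ v (ψ ζ) - 1
  have hpd : DifferentiableOn ℂ p (ball 0 1) := by
    have : DifferentiableOn ℂ (fun ζ => innerSL ℂ v (ψ ζ)) (ball 0 1) :=
      (innerSL ℂ v).differentiable.comp_differentiableOn hψd
    exact this.sub_const 1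
  have hpre : ∀ ζ ∈ ball (0 : ℂ) 1, (p ζ).re ≤ 0 := by
    intro ζ hζ
    have h1 := norm_inner_le_norm (𝕜 := ℂ) v (ψ ζ)
    rw [hvn, one_mul] at h1
    have h2 := (Complex.re_le_norm (inner ℂ v (ψ ζ))).trans (h1.trans (hψn ζ hζ))
    simp only [p, Complex.sub_re, Complex.one_re]
    linarith
  have hp0 : ‖p 0‖ ≤ η := by
    have : p 0 = ((a - 1 : ℝ) : ℂ) := by
      simp only [p, hψ0, inner_smul_right, inner_self_eq_norm_sq_to_K, hvn]
      push_cast; simp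
    rw [this, Complex.norm_real, Real.norm_of_nonpos (by linarith)]
    linarith
  set ζ : ℂ := ((‖z‖ : ℝ) : ℂ) with hζ
  have hζn : ‖ζ‖ = ‖z‖ := by rw [hζ, Complex.norm_real, norm_norm]
  have hζm : ζ ∈ ball (0 : ℂ) 1 := by rw [mem_ball_zero_iff, hζn]; linarith
  have hbc := Complex.borelCaratheodory hη hpd (fun x hx => (hpre x hx).trans hη.le) one_pos hζm
  rw [hζn] at hbc
  have hbc2 : ‖p ζ‖ ≤ 4 * η / (1 - r) := by
    refine hbc.trans ?_
    rw [← add_div]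
    apply div_le_div₀ (by positivity) _ h1r (by linarith)
    nlinarith [norm_nonneg (p 0)]
  have hgz : φ z = ζ • ψ ζ := by
    have h1 := sub_smul_dslope g 0 ζ
    rw [hg0, sub_zero, sub_zero] at h1
    rw [show ψ ζ = dslope g 0 ζ from rfl, h1]
    simp only [g, hzv]
  have hdiff : φ z - z = ζ • (ψ ζ - v) := by
    rw [smul_sub, hzv, hgz]
  rw [hdiff, norm_smul, hζn, mul_pow]
  have hsq : ‖ψ ζ - v‖ ^ 2 ≤ 8 * η / (1 - r) := by
    rw [norm_sub_sq (𝕜 := ℂ), hvn]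
    have h1 := hψn ζ hζm
    have h2 : -(p ζ).re ≤ ‖p ζ‖ := (neg_le_abs _).trans (Complex.abs_re_le_norm _)
    have h3 : RCLike.re (inner ℂ (ψ ζ) v) = (p ζ).re + 1 := by
      rw [inner_re_symm]
      simp [p]
    rw [h3]
    have h4 : 8 * η / (1 - r) = 2 * (4 * η / (1 - r)) := by ring
    rw [h4]
    nlinarith [norm_nonneg (ψ ζ)]
  calc ‖z‖ ^ 2 * ‖ψ ζ - v‖ ^ 2 ≤ 1 * ‖ψ ζ - v‖ ^ 2 := by
        apply mul_le_mul_of_nonneg_right _ (sq_nonneg _)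
        nlinarith
    _ ≤ _ := by rw [one_mul]; exact hsq

lemma near_surj {r : ℝ} (hr : r < 1) : ∃ η > 0, ∀ φ : En n → En n, ∀ a : ℝ,
    Slf n φ a → 1 - η ≤ a → a ≤ 1 → closedBall 0 r ⊆ φ '' Ball n := by
  set d := (1 - r) / 3 with hd
  have hd0 : 0 < d := by rw [hd]; linarith
  set κ := d / 8 with hκ
  have hκ0 : 0 < κ := by positivity
  have hd1 : 1 - (r + 2 * d) = d := by rw [hd]; ring
  refine ⟨κ ^ 2 * d / 8, by positivity, ?_⟩
  intro φ a hφ ha ha1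
  have hclose : ∀ z : En n, ‖z‖ ≤ r + 2 * d → ‖φ z - z‖ ≤ κ := by
    intro z hz
    have h1 := near_id hφ (by positivity) ha ha1 (by linarith : r + 2 * d < 1) hz
    rw [hd1] at h1
    have h2 : 8 * (κ ^ 2 * d / 8) / d = κ ^ 2 := by field_simp
    rw [h2] at h1
    exact (pow_le_pow_iff_left₀ (norm_nonneg _) hκ0.le two_ne_zero).1 h1
  have hpd : DifferentiableOn ℂ (fun z => φ z - z) (Ball n) := hφ.diff.sub differentiableOn_id
  have hfd : ∀ c : En n, ‖c‖ ≤ r + d → ‖fderiv ℂ (fun z => φ z - z) c‖ ≤ 1 / 2 := by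
    intro c hc
    have hsub : ∀ w ∈ ball c d, ‖w‖ ≤ r + 2 * d := by
      intro w hw
      rw [mem_ball_iff_norm] at hw
      have := norm_add_le (w - c) c
      rw [sub_add_cancel] at this
      linarith
    have h1 := Complex.norm_fderiv_le_div_of_mapsTo_ball (f := fun z => φ z - z) (c := c)
      (R₁ := d) (R₂ := 2 * κ)
      (hpd.mono fun w hw => mem_Ball.2 (by have := hsub w hw; linarith)) (by
        intro w hw
        rw [mem_closedBall_iff_norm]
        have h2 := hclose w (hsub w hw)
        have h3 := hclose c (by linarith)
        exact (norm_sub_le _ _).trans (by linarith)) hd0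
    refine h1.trans ?_
    rw [div_le_iff₀ hd0]
    linarith
  intro y hy
  rw [mem_closedBall_zero_iff] at hy
  have hsub : ∀ w ∈ closedBall y d, ‖w‖ ≤ r + d := by
    intro w hw
    rw [mem_closedBall_iff_norm] at hw
    have := norm_add_le (w - y) y
    rw [sub_add_cancel] at this
    linarith
  have hwB : ∀ w ∈ closedBall y d, w ∈ Ball n := fun w hw =>
    mem_Ball.2 (by have := hsub w hw; linarith)
  have hlip : LipschitzOnWith (1 / 2) (fun z => φ z - z) (closedBall y d) := by
    apply LipschitzOnWith.of_dist_le_mul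
    intro x hx w hw
    rw [dist_eq_norm, dist_eq_norm]
    have := (convex_closedBall y d).norm_image_sub_le_of_norm_fderiv_le (𝕜 := ℂ)
      (f := fun z => φ z - z)
      (fun z hz => hpd.differentiableAt (isOpen_Ball.mem_nhds (hwB z hz)))
      (fun z hz => hfd z (hsub z hz)) hw hx
    simpa using this
  obtain ⟨w, hw, hwe⟩ := fix_surj (p := fun z => φ z - z) (x := y) (y := y) (r := d) (k := 1 / 2)
    (by rw [← NNReal.coe_lt_coe]; push_cast; norm_num) hd0.le hlip (by
      rw [add_sub_cancel_left]
      have := hclose y (by linarith)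
      have h9 : (((1 / 2 : NNReal)) : ℝ) = 1 / 2 := by push_cast; rfl
      rw [h9]
      linarith)
  refine ⟨w, hwB w hw, ?_⟩
  rw [← hwe]; abel

end PartD2

section PartD3

variable {n : ℕ}

/-- holomorphic with vanishing one-jet -/
structure H0 (n : ℕ) (g : En n → En n) : Prop where
  diff : DifferentiableOn ℂ g (Ball n)
  zero : g 0 = 0
  der : fderiv ℂ g 0 = 0

def Good (n : ℕ) (F : ℝ → En n → En n) (r u v : ℝ) : Prop :=
  ∀ g, H0 n g → ∀ δ > 0, ∃ q C, Adm n q C ∧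
    ∀ z ∈ closedBall 0 r, ‖g z - q (evolution n F u v z)‖ ≤ δ

lemma ev_slf {F : ℝ → En n → En n} (hF : IsNormalizedLoewnerChain n F)
    {u v : ℝ} (hu : 0 ≤ u) (huv : u ≤ v) : Slf n (evolution n F u v) (Real.exp (u - v)) :=
  ⟨ev_diff hF hu huv, fun _ hz => (ev_spec hF hu huv hz).1, ev_zero hF hu huv,
    ev_fderiv hF hu huv⟩

lemma good_close {F : ℝ → En n → En n} (hF : IsNormalizedLoewnerChain n F) {r : ℝ} (hr0 : 0 < r)
    (hr : r < 1) : ∃ η > 0, ∀ u v, 0 ≤ u → u ≤ v → v - u ≤ η → Good n F r u v := by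
  obtain ⟨r', hrr', hr'1⟩ := exists_between hr
  obtain ⟨η, hη, hsurj⟩ := near_surj (n := n) hr'1
  refine ⟨η, hη, ?_⟩
  intro u v hu huv hclose g hg δ hδ
  set φ := evolution n F u v with hφ
  have hs := hsurj φ _ (ev_slf hF hu huv) (by
    have := Real.add_one_le_exp (u - v); linarith) (Real.exp_le_one_iff.2 (by linarith))
  have hφd := ev_diff hF hu huv
  have hφi := ev_inj hF hu huv
  set χ := Function.invFunOn φ (Ball n) with hχ
  have hχm : ∀ y ∈ ball (0 : En n) r', χ y ∈ Ball n := fun y hy =>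
    Function.invFunOn_mem (hs (ball_subset_closedBall hy))
  have hχd : ∀ y ∈ ball (0 : En n) r', DifferentiableAt ℂ χ y := by
    intro y hy
    obtain ⟨w, hw, rfl⟩ := hs (ball_subset_closedBall hy)
    exact (inv_hasFDeriv isOpen_Ball hφd hφi hw).1
  have hχφ : ∀ z ∈ Ball n, χ (φ z) = z := fun z hz => hφi.leftInvOn_invFunOn hz
  have hφ0 : φ 0 = 0 := ev_zero hF hu huv
  have hχ0 : χ 0 = 0 := by
    have := hχφ 0 zero_mem_Ball
    rwa [hφ0] at this
  have h0r' : (0 : En n) ∈ ball (0 : En n) r' := mem_ball_self (hr0.trans hrr')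
  have hd : DifferentiableOn ℂ (fun y => g (χ y)) (ball 0 r') := fun y hy =>
    ((hg.diff.differentiableAt (isOpen_Ball.mem_nhds (hχm y hy))).comp y
      (hχd y hy)).differentiableWithinAt
  have hder : fderiv ℂ (fun y => g (χ y)) 0 = 0 := by
    have h1 := (hg.diff.differentiableAt (isOpen_Ball.mem_nhds zero_mem_Ball)).hasFDerivAt
    rw [hg.der, ← hχ0] at h1
    have h2 := (h1.comp 0 (hχd 0 h0r').hasFDerivAt).fderiv
    rw [ContinuousLinearMap.zero_comp] at h2
    exact h2
  obtain ⟨q, C, hq, hqa⟩ := taylor_approx hr0 hrr' hδ hd (by simp only [hχ0, hg.zero]) hder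
  refine ⟨q, C, hq, ?_⟩
  intro z hz
  have hzB := closedBall_sub_Ball hr hz
  have h3 := hqa (φ z) (by
    rw [mem_closedBall_zero_iff] at hz ⊢
    exact (ev_norm hF hu huv hzB).trans hz)
  rwa [hχφ z hzB] at h3

lemma good_trans {F : ℝ → En n → En n} (hF : IsNormalizedLoewnerChain n F) {r : ℝ} 
    (hr : r < 1) {u v w : ℝ} (hu : 0 ≤ u) (huv : u ≤ v) (hvw : v ≤ w)
    (h1 : Good n F r u v) (h2 : Good n F r v w) : Good n F r u w := by
  intro g hg δ hδ
  obtain ⟨q1, C1, hq1, ha1⟩ := h1 g hg (δ / 2) (by linarith)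
  obtain ⟨q2, C2, hq2, ha2⟩ := h2 q1 ⟨hq1.diff, hq1.zero, hq1.der⟩ (δ / 2) (by linarith)
  refine ⟨q2, C2, hq2, ?_⟩
  intro z hz
  have hzB := closedBall_sub_Ball hr hz
  have e1 := ha1 z hz
  have e2 := ha2 (evolution n F u v z) (by
    rw [mem_closedBall_zero_iff] at hz ⊢
    exact (ev_norm hF hu huv hzB).trans hz)
  rw [ev_comp hF hu huv hvw hzB]
  refine (norm_sub_le_norm_sub_add_norm_sub _ (q1 (evolution n F u v z)) _).trans ?_
  linarith

lemma good_all {F : ℝ → En n → En n} (hF : IsNormalizedLoewnerChain n F) {r : ℝ} (hr0 : 0 < r)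
    (hr : r < 1) {u v : ℝ} (hu : 0 ≤ u) (huv : u ≤ v) : Good n F r u v := by
  obtain ⟨η, hη, hc⟩ := good_close hF hr0 hr
  have key : ∀ k : ℕ, ∀ v, u ≤ v → v - u ≤ k * η → Good n F r u v := by
    intro k
    induction k with
    | zero =>
      intro v huv hv
      simp only [Nat.cast_zero, zero_mul] at hv
      exact hc u v hu huv (by linarith)
    | succ k ih =>
      intro v huv hv
      push_cast at hv
      set m := max u (v - η) with hm
      have h1 : u ≤ m := le_max_left _ _
      have h2 : m ≤ v := max_le huv (by linarith)
      have h3 : v - η ≤ m := le_max_right _ _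
      refine good_trans hF hr hu h1 h2 (ih m h1 ?_) (hc m v (hu.trans h1) h2 (by linarith))
      have : m ≤ u + k * η := max_le (by nlinarith [Nat.cast_nonneg (α := ℝ) k]) (by linarith)
      linarith
  obtain ⟨k, hk⟩ := exists_nat_ge ((v - u) / η)
  exact key k v huv ((div_le_iff₀ hη).1 hk)

lemma functional_zero {F : ℝ → En n → En n} (hF : IsNormalizedLoewnerChain n F)
    {s t : ℝ} (hs : 0 ≤ s) (hst : s ≤ t) {L : (En n → En n) → ℂ}
    (hL : IsContinuousLinearFunctional n L)
    (hmax : ∀ g, MemS0 n g → (L g).re ≤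
      (L (fun z => (Real.exp (t - s) : ℂ) • evolution n F s t z)).re)
    {q : En n → En n} {C : ℝ} (hq : Adm n q C) : L (fun z => q (evolution n F s t z)) = 0 := by
  set φ := evolution n F s t with hφ
  set E : ℂ := (Real.exp (t - s) : ℂ) with hE
  have hE0 : E ≠ 0 := by rw [hE]; exact_mod_cast (Real.exp_pos (t - s)).ne'
  set l := L (fun z => q (φ z)) with hl
  have hle : ∀ ε : ℂ, ‖ε‖ * C ≤ 1 / 4 → (E * (ε * l)).re ≤ 0 := by
    intro ε hε
    have h1 := hmax _ (memS0_pert hF hs hst hq hε)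
    have h2 : (fun z => E • (φ z + ε • q (φ z))) = (fun z => E • φ z) + E • (ε • fun z => q (φ z)) := by
      funext z
      simp [smul_add]
    rw [h2, hL.1, hL.2.1, hL.2.1, Complex.add_re] at h1
    linarith
  by_contra hne
  set d : ℝ := 1 / (4 * (C + 1) * ‖l‖) with hd
  have hln : 0 < ‖l‖ := norm_pos_iff.2 hne
  have hC := hq.nonneg
  have hd0 : 0 < d := by positivity
  have h3 := hle ((d : ℂ) * (starRingEnd ℂ) l) (by
    rw [norm_mul, Complex.norm_real, Real.norm_of_nonneg hd0.le, Complex.norm_conj, hd]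
    have : 1 / (4 * (C + 1) * ‖l‖) * ‖l‖ * C = C / (4 * (C + 1)) := by field_simp
    rw [this, div_le_div_iff₀ (by positivity) (by norm_num)]
    linarith)
  have h4 : E * ((d : ℂ) * (starRingEnd ℂ) l * l) = ((Real.exp (t - s) * (d * ‖l‖ ^ 2) : ℝ) : ℂ) := by
    rw [mul_assoc, mul_comm ((starRingEnd ℂ) l) l, Complex.mul_conj, Complex.normSq_eq_norm_sq, hE]
    push_cast; ring
  rw [h4, Complex.ofReal_re] at h3
  have h5 : 0 < Real.exp (t - s) * (d * ‖l‖ ^ 2) := mul_pos (Real.exp_pos _) (by positivity)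
  linarith

lemma functional_H0 {F : ℝ → En n → En n} (hF : IsNormalizedLoewnerChain n F)
    {s t : ℝ} (hs : 0 ≤ s) (hst : s ≤ t) {L : (En n → En n) → ℂ}
    (hL : IsContinuousLinearFunctional n L)
    (hmax : ∀ g, MemS0 n g → (L g).re ≤
      (L (fun z => (Real.exp (t - s) : ℂ) • evolution n F s t z)).re)
    {g : En n → En n} (hg : H0 n g) : L g = 0 := by
  have hex : ∀ k : ℕ, ∃ q C, Adm n q C ∧ ∀ z ∈ closedBall (0 : En n) (1 - 1 / ((k : ℝ) + 2)),
      ‖g z - q (evolution n F s t z)‖ ≤ 1 / ((k : ℝ) + 1) := by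
    intro k
    have hk : (0 : ℝ) ≤ k := Nat.cast_nonneg k
    refine good_all hF ?_ ?_ hs hst g hg _ (by positivity)
    · rw [sub_pos, div_lt_one (by linarith)]; linarith
    · have : 0 < 1 / ((k : ℝ) + 2) := by positivity
      linarith
  choose q C hq hqa using hex
  have hlim := hL.2.2 (fun k z => q k (evolution n F s t z)) g
    (fun k => (hq k).diff.comp (ev_diff hF hs hst) (fun z hz => (ev_spec hF hs hst hz).1))
    hg.diff (by
      rw [tendstoLocallyUniformlyOn_iff_forall_isCompact isOpen_Ball]
      intro K hKB hK
      obtain ⟨r, hr0, hr1, hKr⟩ := exists_r hK hKB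
      rw [Metric.tendstoUniformlyOn_iff]
      intro ε hε
      have h1 : Tendsto (fun k : ℕ => 1 / ((k : ℝ) + 1)) atTop (𝓝 0) :=
        tendsto_one_div_add_atTop_nhds_zero_nat
      filter_upwards [h1.eventually (gt_mem_nhds hε),
        h1.eventually (gt_mem_nhds (by linarith : 0 < 1 - r))] with k hk1 hk2 z hz
      rw [dist_eq_norm]
      refine (hqa k z ?_).trans_lt hk1
      have hzr := hKr hz
      rw [mem_closedBall_zero_iff] at hzr ⊢
      have h3 : 1 / ((k : ℝ) + 2) ≤ 1 / ((k : ℝ) + 1) := by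
        apply one_div_le_one_div_of_le (by positivity); linarith
      linarith)
  have h0 : ∀ k, L (fun z => q k (evolution n F s t z)) = 0 := fun k =>
    functional_zero hF hs hst hL hmax (hq k)
  simp only [h0] at hlim
  exact tendsto_nhds_unique hlim tendsto_const_nhds

end PartD3

end

open scoped Topology

/-- The maps h = e^{t−s}·φ_{s,t} coming from an evolution family of a
normalized Loewner chain with normal family normalization are not support
points of S⁰(𝔹ₙ). -/
theorem not_isSupportPoint_exp_smul_evolution (n : ℕ) (F : ℝ → En n → En n)
    (hF : IsNormalizedLoewnerChain n F) (hN : IsNormalFamilyChain n F)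
    (s t : ℝ) (hs : 0 ≤ s) (hst : s ≤ t) :
    ¬ IsSupportPoint n {g | MemS0 n g}
        (fun z => (Real.exp (t - s) : ℂ) • evolution n F s t z) := by
  rintro ⟨-, L, hL, ⟨g₁, hg₁, g₂, hg₂, hne⟩, hmax⟩
  apply hne
  have hg₁' : ClassS n g₁ := hg₁.1
  have hg₂' : ClassS n g₂ := hg₂.1
  have hd1 := hg₁'.1.1.differentiableAt (isOpen_Ball.mem_nhds zero_mem_Ball)
  have hd2 := hg₂'.1.1.differentiableAt (isOpen_Ball.mem_nhds zero_mem_Ball)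
  have hH : H0 n (g₁ - g₂) := by
    refine ⟨hg₁'.1.1.sub hg₂'.1.1, ?_, ?_⟩
    · simp [hg₁'.2.1, hg₂'.2.1]
    · rw [fderiv_sub hd1 hd2, hg₁'.2.2, hg₂'.2.2, sub_self]
  have h0 := functional_H0 hF hs hst hL (fun g hg => hmax g hg) hH
  have h1 : g₁ = (g₁ - g₂) + g₂ := by simp
  rw [h1, hL.1, h0, zero_add]

end
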